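/- Let A be a finite-dimensional hereditary algebra over a field k, and let M be a 2-term complex in the bounded homotopy category K^b(proj A) (concentrated in degrees −1 and 0). If M is presilting (Hom(M, M[i]) = 0 for all i > 0) and the number of non-isomorphic indecomposable direct summands of M equals the number of non-isomorphic indecomposable direct summands of A, then M is silting, i.e., thick(M) = K^b(proj A). -/

import Mathlib

open CategoryTheory Limits Pretriangulated

/-- The (unbounded) homotopy category of cochain complexes of `A`-modules, in which the
bounded homotopy category `K^b(proj A)` sits as the subcategory of objects isomorphic to
bounded complexes of finitely generated projectives. -/
abbrev Kb (A : Type) [Ring A] :=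
  HomotopyCategory (ModuleCat A) (ComplexShape.up ℤ)

/-- An object of the homotopy category belongs to `K^b(proj A)`: it is isomorphic to a
bounded complex of finitely generated projective `A`-modules. -/
def inKbProj {A : Type} [Ring A] (X : Kb A) : Prop :=
  ∃ C : CochainComplex (ModuleCat A) ℤ,
    (∃ a b : ℤ, ∀ i : ℤ, (i < a ∨ b < i) → IsZero (C.X i)) ∧
    (∀ i : ℤ, Projective (C.X i) ∧ Module.Finite A (C.X i)) ∧
    Nonempty (((HomotopyCategory.quotient (ModuleCat A) (ComplexShape.up ℤ)).obj C) ≅ X)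

/-- `N` is a direct summand of `M` (i.e. `N` is a retract of `M`). -/
def IsSummandOf {A : Type} [Ring A] (N M : Kb A) : Prop :=
  ∃ (i : N ⟶ M) (r : M ⟶ N), i ≫ r = 𝟙 N

/-- `N` is indecomposable: it is nonzero and its only idempotent endomorphisms are `0`
and the identity. -/
def IndecObj {A : Type} [Ring A] (N : Kb A) : Prop :=
  ¬ IsZero N ∧ ∀ e : N ⟶ N, e ≫ e = e → e = 0 ∨ e = 𝟙 N

/-- `|M|`: the number of isomorphism classes of indecomposable direct summands of `M`. -/
noncomputable def numIndecSummands {A : Type} [Ring A] (M : Kb A) : ℕ :=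
  Nat.card (Quot (fun (X Y : {N : Kb A // IndecObj N ∧ IsSummandOf N M}) =>
    Nonempty (X.1 ≅ Y.1)))

/-- An `A`-module is indecomposable if it is nontrivial and admits no nontrivial
direct sum decomposition. -/
def IndecModule (A : Type) [Ring A] (N : Type) [AddCommGroup N] [Module A N] : Prop :=
  Nontrivial N ∧ ∀ p q : Submodule A N, IsCompl p q → p = ⊥ ∨ q = ⊥

/-- `|A|`: the number of isomorphism classes of indecomposable direct summands of the
regular module `A`. -/
noncomputable def numIndecSummandsRing (A : Type) [Ring A] : ℕ :=
  Nat.card (Quot (fun (X Y : {N : Submodule A A //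
      (∃ N' : Submodule A A, IsCompl N N') ∧ IndecModule A N}) =>
    Nonempty (X.1 ≃ₗ[A] Y.1)))

/-- The smallest class of objects of the homotopy category containing `M` and closed
under isomorphisms, shifts, cones of distinguished triangles and direct summands:
the thick subcategory `thick(M)` generated by `M`. -/
def thickClosure {A : Type} [Ring A] (M : Kb A) : Set (Kb A) := fun X =>
  ∀ S : Set (Kb A),
    M ∈ S →
    (∀ Y Z : Kb A, (Y ≅ Z) → Y ∈ S → Z ∈ S) →
    (∀ Y : Kb A, Y ∈ S → Y⟦(1 : ℤ)⟧ ∈ S ∧ Y⟦(-1 : ℤ)⟧ ∈ S) →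
    (∀ T : Triangle (Kb A), (T ∈ distTriang (Kb A)) →
      T.obj₁ ∈ S → T.obj₂ ∈ S → T.obj₃ ∈ S) →
    (∀ Y Z : Kb A, IsSummandOf Y Z → Z ∈ S → Y ∈ S) →
    X ∈ S

universe u

section RingLemmas

/-- Fitting: in a finite-dimensional algebra some power of `x` is `x ^ (2 n) * y`, giving an
idempotent. -/
theorem fitting_idem {k R : Type*} [Field k] [Ring R] [Algebra k R] [FiniteDimensional k R] (x : R) :
    ∃ (n : ℕ) (y : R), 0 < n ∧ Commute x y ∧ x ^ n = x ^ n * x ^ n * y := by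
  let B := Algebra.adjoin k ({x} : Set R)
  letI : CommRing B := { (inferInstance : Ring B) with
    mul_comm := (Algebra.adjoinCommRingOfComm k (s := ({x} : Set R)) (by
      rintro a rfl b rfl; rfl)).mul_comm }
  have hx : x ∈ B := Algebra.subset_adjoin rfl
  let X : B := ⟨x, hx⟩
  haveI : FiniteDimensional k B := inferInstanceAs (FiniteDimensional k B.toSubmodule)
  haveI : IsArtinian B B := isArtinian_of_tower k inferInstance
  obtain ⟨n, y, hy⟩ := IsArtinian.exists_pow_succ_smul_dvd X (1 : B)
  have hy' : X ^ n = X ^ n * (X * y) := by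
    simp only [smul_eq_mul, mul_one] at hy
    rw [← mul_assoc, ← pow_succ, hy]
  have key : ∀ m : ℕ, X ^ n = X ^ n * (X * y) ^ m := by
    intro m
    induction m with
    | zero => simp
    | succ m ih => rw [pow_succ, ← mul_assoc, ← ih, ← hy']
  have h2 : X ^ (n+1) = X ^ (n+1) * X ^ (n+1) * y ^ (n+1) := by
    have := key (n+1)
    rw [mul_pow] at this
    calc X ^ (n+1) = X * X ^ n := by rw [pow_succ, mul_comm]
      _ = X * (X ^ n * (X ^ (n+1) * y ^ (n+1))) := by rw [← this]
      _ = _ := by ring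
  refine ⟨n+1, ((y ^ (n+1) : B) : R), Nat.succ_pos _, ?_, ?_⟩
  · have := congrArg (Subtype.val) (mul_comm X (y ^ (n+1)))
    exact this
  · exact congrArg Subtype.val h2

theorem fitting_idem' {k R : Type*} [Field k] [Ring R] [Algebra k R] [FiniteDimensional k R] (x : R) :
    ∃ (n : ℕ) (y : R), 0 < n ∧ Commute x y ∧ x ^ n = x ^ n * x ^ n * y ∧
      (x ^ n * y) * (x ^ n * y) = x ^ n * y := by
  obtain ⟨n, y, hn, hc, h⟩ := fitting_idem (k := k) x
  refine ⟨n, y, hn, hc, h, ?_⟩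
  have hc' : Commute (x ^ n) y := hc.pow_left n
  calc (x ^ n * y) * (x ^ n * y) = x ^ n * (y * x ^ n) * y := by simp only [mul_assoc]
    _ = x ^ n * (x ^ n * y) * y := by rw [hc'.eq]
    _ = (x ^ n * x ^ n * y) * y := by simp only [mul_assoc]
    _ = _ := by rw [← h]

theorem unit_or_nilp (k : Type*) {R : Type*} [Field k] [Ring R] [Algebra k R] [FiniteDimensional k R]
    (h : ∀ e : R, e * e = e → e = 0 ∨ e = 1) (x : R) : IsUnit x ∨ IsNilpotent x := by
  obtain ⟨n, y, hn, hc, h1, h2⟩ := fitting_idem' (k := k) x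
  rcases h _ h2 with h0 | h0
  · right
    refine ⟨n, ?_⟩
    rw [h1, mul_assoc, h0, mul_zero]
  · left
    obtain ⟨m, rfl⟩ : ∃ m, n = m + 1 := ⟨n - 1, by omega⟩
    have h3 : x * (x ^ m * y) = 1 := by rw [← mul_assoc, ← pow_succ', h0]
    have h4 : (x ^ m * y) * x = 1 := by
      rw [mul_assoc, ← hc.eq, ← mul_assoc, ← pow_succ, h0]
    exact ⟨⟨x, x ^ m * y, h3, h4⟩, rfl⟩

theorem lift_idem (k : Type*) {R R' : Type*} [Field k] [Ring R] [Ring R'] [Algebra k R]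
    [FiniteDimensional k R] (φ : R →+* R') (hφ : Function.Surjective φ) (e : R') (he : e * e = e) :
    ∃ p : R, p * p = p ∧ φ p = e := by
  obtain ⟨x, rfl⟩ := hφ e
  obtain ⟨n, y, hn, hc, h1, h2⟩ := fitting_idem' (k := k) x
  refine ⟨_, h2, ?_⟩
  have hp : ∀ m : ℕ, 0 < m → φ x ^ m = φ x := by
    intro m hm
    induction m, hm using Nat.le_induction with
    | base => simp
    | succ m hm ih => rw [pow_succ, ih, he]
  have := congrArg φ h1
  simp only [map_mul, map_pow, hp n hn, he] at this ⊢
  exact this.symm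

theorem nonunit_mem_jac (k : Type*) {R : Type*} [Field k] [Ring R] [Algebra k R]
    [FiniteDimensional k R] (h : ∀ e : R, e * e = e → e = 0 ∨ e = 1) (x : R) (hx : ¬ IsUnit x) :
    x ∈ Ring.jacobson R := by
  rw [← Ideal.jacobson_bot, Ideal.mem_jacobson_iff]
  intro y
  have hyx : IsNilpotent (y * x) := by
    rcases unit_or_nilp k h (y * x) with hu | hn
    · exfalso
      rcases unit_or_nilp k h x with h1 | ⟨n, hn⟩
      · exact hx h1
      · obtain ⟨u, hu⟩ := hu
        have hz : (↑u⁻¹ * y) * x = 1 := by rw [mul_assoc, ← hu]; simp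
        have : ∀ m : ℕ, (↑u⁻¹ * y) ^ m * x ^ m = 1 := by
          intro m
          induction m with
          | zero => simp
          | succ m ih =>
            rw [pow_succ, pow_succ' x, mul_assoc, ← mul_assoc _ x, hz, one_mul, ih]
        have h10 : (1 : R) = 0 := by rw [← this n, hn, mul_zero]
        haveI : Subsingleton R := subsingleton_of_zero_eq_one h10.symm
        exact hx (isUnit_of_subsingleton x)
    · exact hn
  obtain ⟨u, hu⟩ := hyx.isUnit_add_one
  refine ⟨(↑u⁻¹ : R), ?_⟩
  have : (↑u⁻¹ : R) * (y * x + 1) = 1 := by rw [← hu]; simp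
  rw [mul_add, mul_one, ← mul_assoc] at this
  rw [this, sub_self]
  exact Submodule.zero_mem _

theorem jac_nilp (k : Type*) {R : Type*} [Field k] [Ring R] [Algebra k R]
    [FiniteDimensional k R] : ∃ L : ℕ, (Ring.jacobson R) ^ L = ⊥ := by
  haveI : IsArtinianRing R := isArtinian_of_tower k inferInstance
  obtain ⟨L, hL⟩ := IsSemiprimaryRing.isNilpotent (R := R)
  exact ⟨L, hL⟩

end RingLemmas

section Abstract

variable {C : Type*} [Category C] [Preadditive C]

/-- Indecomposability in a preadditive category. -/
def Indec (N : C) : Prop := ¬ IsZero N ∧ ∀ e : N ⟶ N, e ≫ e = e → e = 0 ∨ e = 𝟙 N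

theorem isIso_of_comp_left {X Y Z : C} (hX : Indec X) (hY : Indec Y) (g : X ⟶ Y) (a : Y ⟶ Z)
    (h : IsIso (g ≫ a)) : IsIso g := by
  have h1 : (g ≫ a) ≫ inv (g ≫ a) = 𝟙 _ := IsIso.hom_inv_id _
  rw [Category.assoc] at h1
  rcases hY.2 (a ≫ inv (g ≫ a) ≫ g) (by
    simp only [Category.assoc]; rw [reassoc_of% h1]) with h0 | h0
  · exfalso
    apply hX.1
    have : g = 0 := by
      have := congrArg (fun t => g ≫ t) h0
      simp only [comp_zero] at this
      rw [reassoc_of% h1] at this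
      exact this
    have h2 : g ≫ a ≫ inv (g ≫ a) = 0 := by
      conv_lhs => rw [← Category.assoc]
      generalize hw : inv (g ≫ a) = w
      rw [this]; simp
    rw [IsZero.iff_id_eq_zero, ← h1, h2]
  · exact ⟨a ≫ inv (g ≫ a), h1, by simpa using h0⟩

theorem end_trivial_idem {Y : C} (hY : Indec Y) : ∀ e : End Y, e * e = e → e = 0 ∨ e = 1 :=
  fun e he => hY.2 e he

theorem isIso_of_retract_indec {X Y : C} (hX : Indec X) (hY : Indec Y) (i : X ⟶ Y) (r : Y ⟶ X)
    (h : i ≫ r = 𝟙 X) : IsIso i :=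
  isIso_of_comp_left hX hY i r (by rw [h]; infer_instance)

/-- An indecomposable whose identity factors as a sum through two objects. -/
theorem indec_split (k : Type*) [Field k] [Linear k C] {Y Z W : C} (hY : Indec Y)
    [FiniteDimensional k (End Y)] (a : Y ⟶ Z) (b : Z ⟶ Y) (c : Y ⟶ W) (d : W ⟶ Y)
    (h : a ≫ b + c ≫ d = 𝟙 Y) :
    (∃ (i : Y ⟶ Z) (r : Z ⟶ Y), i ≫ r = 𝟙 Y) ∨ (∃ (i : Y ⟶ W) (r : W ⟶ Y), i ≫ r = 𝟙 Y) := by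
  rcases unit_or_nilp k (end_trivial_idem hY) (End.of (a ≫ b)) with hu | hn
  · left
    haveI : IsIso (a ≫ b) := (isUnit_iff_isIso _).1 hu
    exact ⟨a, b ≫ inv (a ≫ b), by rw [← Category.assoc, IsIso.hom_inv_id]⟩
  · right
    have hu := hn.isUnit_one_sub
    have e : (1 : End Y) - End.of (a ≫ b) = End.of (c ≫ d) := by
      rw [sub_eq_iff_eq_add]; 
      exact (h.symm.trans (add_comm _ _))
    rw [e] at hu
    haveI : IsIso (c ≫ d) := (isUnit_iff_isIso _).1 hu
    exact ⟨c, d ≫ inv (c ≫ d), by rw [← Category.assoc, IsIso.hom_inv_id]⟩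

/-- Morphisms `G ⟶ T j` generated by radical maps from `T i`, `i ∈ S`. -/
def radCl {I : Type*} (G : C) (T : I → C) (S : Finset I) (j : I) : AddSubgroup (G ⟶ T j) :=
  AddSubgroup.closure {x | ∃ i ∈ S, ∃ (y : G ⟶ T i) (g : T i ⟶ T j), ¬ IsIso g ∧ x = y ≫ g}

theorem radCl_comp {I : Type*} (G : C) (T : I → C) (hT : ∀ i, Indec (T i)) (S : Finset I) {i j : I}
    (x : G ⟶ T i) (hx : x ∈ radCl G T S i) (a : T i ⟶ T j) : x ≫ a ∈ radCl G T S j := by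
  induction hx using AddSubgroup.closure_induction with
  | mem x hx =>
    obtain ⟨l, hl, y, g, hg, rfl⟩ := hx
    refine AddSubgroup.subset_closure ⟨l, hl, y, g ≫ a, ?_, by simp⟩
    intro h
    exact hg (isIso_of_comp_left (hT l) (hT i) g a h)
  | zero => rw [zero_comp]; exact AddSubgroup.zero_mem _
  | add x y _ _ hx hy => rw [Preadditive.add_comp]; exact AddSubgroup.add_mem _ hx hy
  | neg x _ hx => rw [Preadditive.neg_comp]; exact AddSubgroup.neg_mem _ hx

theorem nakayama_finset (k : Type*) [Field k] [Linear k C] {I : Type*} (G : C) (T : I → C)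
    (hT : ∀ i, Indec (T i)) (hfd : ∀ i, FiniteDimensional k (End (T i))) (S : Finset I) :
    (∀ j ∈ S, ∀ x : G ⟶ T j, x ∈ radCl G T S j) → ∀ j ∈ S, ∀ x : G ⟶ T j, x = 0 := by
  classical
  induction S using Finset.induction_on with
  | empty => intro _ j hj; simp at hj
  | insert a S haS ih =>
    intro h
    have hJ : ∀ g : End (T a), ¬ IsIso g → g ∈ Ring.jacobson (End (T a)) := by
      intro g hg
      haveI := hfd a
      exact nonunit_mem_jac k (end_trivial_idem (hT a)) g (fun hu => hg ((isUnit_iff_isIso _).1 hu))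
    have h1 : ∀ x : G ⟶ T a, x ∈ radCl G T S a := by
      have step : ∀ l : ℕ, ∀ x : G ⟶ T a, x ∈ AddSubgroup.closure
          {x : G ⟶ T a | ∃ (y : G ⟶ T a) (g : End (T a)), g ∈ (Ring.jacobson (End (T a))) ^ l ∧
            x = y ≫ g} ⊔ radCl G T S a := by
        intro l
        induction l with
        | zero =>
          intro x
          refine AddSubgroup.mem_sup_left (AddSubgroup.subset_closure ⟨x, 𝟙 _, ?_, by simp⟩)
          rw [Submodule.pow_zero]
          exact Submodule.one_le.1 le_rfl
        | succ l ihl =>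
          intro x
          obtain ⟨u, hu, v, hv, rfl⟩ := AddSubgroup.mem_sup.1 (ihl x)
          refine AddSubgroup.add_mem _ ?_ (AddSubgroup.mem_sup_right hv)
          clear hv v
          induction hu using AddSubgroup.closure_induction with
          | zero => exact AddSubgroup.zero_mem _
          | add x y _ _ hx hy => exact AddSubgroup.add_mem _ hx hy
          | neg x _ hx => exact AddSubgroup.neg_mem _ hx
          | mem u hu =>
            obtain ⟨z, g, hg, rfl⟩ := hu
            have hz := h a (Finset.mem_insert_self _ _) z
            induction hz using AddSubgroup.closure_induction with
            | zero => rw [zero_comp]; exact AddSubgroup.zero_mem _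
            | add x y _ _ hx hy => rw [Preadditive.add_comp]; exact AddSubgroup.add_mem _ hx hy
            | neg x _ hx => rw [Preadditive.neg_comp]; exact AddSubgroup.neg_mem _ hx
            | mem z hz =>
              obtain ⟨i, hi, y, g', hg', rfl⟩ := hz
              rw [Finset.mem_insert] at hi
              rcases hi with rfl | hi
              · refine AddSubgroup.mem_sup_left (AddSubgroup.subset_closure ⟨y, g' ≫ g, ?_, by simp⟩)
                exact (Submodule.pow_succ (M := Ring.jacobson (End (T i))) (n := l)) ▸
                  (Ideal.mul_mem_mul hg (hJ g' hg'))
              · refine AddSubgroup.mem_sup_right ?_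
                refine radCl_comp G T hT S (y ≫ g') (AddSubgroup.subset_closure ⟨i, hi, y, g', hg', rfl⟩) g
      haveI := hfd a
      obtain ⟨L, hL⟩ := jac_nilp k (R := End (T a))
      intro x
      obtain ⟨u, hu, v, hv, rfl⟩ := AddSubgroup.mem_sup.1 (step L x)
      refine AddSubgroup.add_mem _ ?_ hv
      have : u = 0 := by
        clear hv v
        induction hu using AddSubgroup.closure_induction with
        | zero => rfl
        | add x y _ _ hx hy => rw [hx, hy, add_zero]
        | neg x _ hx => rw [hx, neg_zero]
        | mem u hu =>
          obtain ⟨z, g, hg, rfl⟩ := hu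
          rw [hL] at hg
          have : g = 0 := hg
          rw [this]
          exact comp_zero
      rw [this]; exact AddSubgroup.zero_mem _
    have h2 : ∀ j ∈ S, ∀ x : G ⟶ T j, x ∈ radCl G T S j := by
      intro j hj x
      have hx := h j (Finset.mem_insert_of_mem hj) x
      induction hx using AddSubgroup.closure_induction with
      | zero => exact AddSubgroup.zero_mem _
      | add x y _ _ hx hy => exact AddSubgroup.add_mem _ hx hy
      | neg x _ hx => exact AddSubgroup.neg_mem _ hx
      | mem u hu =>
        obtain ⟨i, hi, y, g, hg, rfl⟩ := hu
        rw [Finset.mem_insert] at hi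
        rcases hi with rfl | hi
        · exact radCl_comp G T hT S y (h1 y) g
        · exact AddSubgroup.subset_closure ⟨i, hi, y, g, hg, rfl⟩
    have h3 := ih h2
    intro j hj x
    rw [Finset.mem_insert] at hj
    rcases hj with rfl | hj
    · have hx := h1 x
      induction hx using AddSubgroup.closure_induction with
      | zero => rfl
      | add x y _ _ hx hy => rw [hx, hy, add_zero]
      | neg x _ hx => rw [hx, neg_zero]
      | mem u hu =>
        obtain ⟨i, hi, y, g, hg, rfl⟩ := hu
        rw [h3 i hi y, zero_comp]
    · exact h3 j hj x

end Abstract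

section Basic

variable {A : Type} [Ring A]

/-- The quotient functor to the homotopy category. -/
abbrev Qf (A : Type) [Ring A] := HomotopyCategory.quotient (ModuleCat.{u} A) (ComplexShape.up ℤ)

theorem finite_of_retract {X Y : ModuleCat.{u} A} (i : X ⟶ Y) (r : Y ⟶ X) (h : i ≫ r = 𝟙 X)
    (hY : Module.Finite A Y) : Module.Finite A X := by
  refine Module.Finite.of_surjective r.hom ?_
  intro x
  refine ⟨i.hom x, ?_⟩
  have := congrArg (fun t => t.hom x) h
  simpa using this

theorem projective_of_retract {X Y : ModuleCat.{u} A} (i : X ⟶ Y) (r : Y ⟶ X) (h : i ≫ r = 𝟙 X)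
    (hY : Projective Y) : Projective X :=
  Retract.projective ⟨i, r, h⟩ 

theorem isZero_of_retract {V : Type*} [Category V] [Preadditive V]
    {X Y : V} (i : X ⟶ Y) (r : Y ⟶ X) (h : i ≫ r = 𝟙 X)
    (hY : IsZero Y) : IsZero X := by
  rw [IsZero.iff_id_eq_zero, ← h, hY.eq_of_tgt i 0, zero_comp]

variable (k : Type) [Field k] [Algebra k A] [FiniteDimensional k A]

open scoped ModuleCat in
theorem fd_of_finite (X : ModuleCat.{u} A) (hX : Module.Finite A X) : FiniteDimensional k X :=
  Module.Finite.trans A X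

open scoped ModuleCat in
theorem fd_hom (X Y : ModuleCat.{u} A) (hX : Module.Finite A X) (hY : Module.Finite A Y) :
    FiniteDimensional k (X ⟶ Y) := by
  haveI := fd_of_finite k X hX
  haveI := fd_of_finite k Y hY
  let φ : (X ⟶ Y) →ₗ[k] (X →ₗ[k] Y) :=
    { toFun := fun f => f.hom.restrictScalars k
      map_add' := fun f g => rfl
      map_smul' := fun c f => rfl }
  refine FiniteDimensional.of_injective φ ?_
  intro f g h
  ext x
  exact congrArg (fun t => t x) h

theorem fd_hom_complex (C D : CochainComplex (ModuleCat.{u} A) ℤ) (a b : ℤ)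
    (hC : ∀ i, (i < a ∨ b < i) → IsZero (C.X i))
    (hCf : ∀ i, Module.Finite A (C.X i)) (hDf : ∀ i, Module.Finite A (D.X i)) :
    FiniteDimensional k (C ⟶ D) := by
  haveI : ∀ i, FiniteDimensional k (C.X i ⟶ D.X i) := fun i => fd_hom k _ _ (hCf i) (hDf i)
  let φ : (C ⟶ D) →ₗ[k] ((i : Finset.Icc a b) → (C.X i ⟶ D.X i)) :=
    { toFun := fun f i => f.f i
      map_add' := fun f g => rfl
      map_smul' := fun c f => rfl }
  refine FiniteDimensional.of_injective φ ?_
  intro f g h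
  ext i : 1
  by_cases hi : i ∈ Finset.Icc a b
  · exact congrFun h ⟨i, hi⟩
  · apply (hC i _).eq_of_src
    rw [Finset.mem_Icc] at hi
    omega

theorem fd_hom_K (C D : CochainComplex (ModuleCat.{u} A) ℤ) [FiniteDimensional k (C ⟶ D)] :
    FiniteDimensional k ((Qf.{u} A).obj C ⟶ (Qf.{u} A).obj D) := by
  refine Module.Finite.of_surjective ((Qf.{u} A).mapLinearMap k (X := C) (Y := D)) ?_
  exact (Qf.{u} A).map_surjective

/-- Splitting idempotents of the homotopy category at the chain level. -/
theorem split_idem (C : CochainComplex (ModuleCat.{u} A) ℤ) [h : FiniteDimensional k (C ⟶ C)]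
    (e : (Qf.{u} A).obj C ⟶ (Qf.{u} A).obj C) (he : e ≫ e = e) :
    ∃ (T : CochainComplex (ModuleCat.{u} A) ℤ) (ι : T ⟶ C) (π : C ⟶ T), ι ≫ π = 𝟙 T ∧
      (Qf.{u} A).map (π ≫ ι) = e := by
  haveI : FiniteDimensional k (End C) := h
  let Φ : End C →+* End ((Qf.{u} A).obj C) :=
    { toFun := fun x => (Qf.{u} A).map x
      map_one' := (Qf.{u} A).map_id C
      map_mul' := fun x y => (Qf.{u} A).map_comp y x
      map_zero' := (Qf.{u} A).map_zero C C
      map_add' := fun x y => (Qf.{u} A).map_add }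
  obtain ⟨p, hp, hpe⟩ := lift_idem k Φ (by
    intro x; exact (Qf.{u} A).map_surjective x) (End.of e) he
  obtain ⟨T, ι, π, h1, h2⟩ := IsIdempotentComplete.idempotents_split C (show C ⟶ C from p) hp
  exact ⟨T, ι, π, h1, by rw [h2]; exact hpe⟩

theorem split_retract (C : CochainComplex (ModuleCat.{u} A) ℤ) [FiniteDimensional k (C ⟶ C)]
    (N : Kb.{u} A) (i : N ⟶ (Qf.{u} A).obj C) (r : (Qf.{u} A).obj C ⟶ N) (hir : i ≫ r = 𝟙 N) :
    ∃ (T : CochainComplex (ModuleCat.{u} A) ℤ) (ι : T ⟶ C) (π : C ⟶ T), ι ≫ π = 𝟙 T ∧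
      Nonempty ((Qf.{u} A).obj T ≅ N) := by
  obtain ⟨T, ι, π, h1, h2⟩ := split_idem k C (r ≫ i) (by
    simp only [Category.assoc]; rw [reassoc_of% hir])
  refine ⟨T, ι, π, h1, ⟨⟨(Qf.{u} A).map ι ≫ r, i ≫ (Qf.{u} A).map π, ?_, ?_⟩⟩⟩
  · have : (Qf.{u} A).map ι ≫ (r ≫ i) ≫ (Qf.{u} A).map π = 𝟙 _ := by
      rw [← h2, ← Functor.map_comp, ← Functor.map_comp]
      simp only [Category.assoc]
      rw [reassoc_of% h1, h1, CategoryTheory.Functor.map_id]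
    simpa using this
  · have : i ≫ (r ≫ i) ≫ r = 𝟙 N := by
      simp only [Category.assoc]; rw [reassoc_of% hir, hir]
    rw [← h2, Functor.map_comp] at this
    simpa using this

end Basic

section Mk2

variable {A : Type} [Ring A]

/-- The objects of a two-term complex. -/
@[reducible] noncomputable def mk2X (P₁ P₀ : ModuleCat.{u} A) : ℤ → ModuleCat.{u} A
  | Int.negSucc 0 => P₁
  | Int.ofNat 0 => P₀
  | _ => ModuleCat.of A PUnit.{u+1}

/-- The differentials of a two-term complex. -/
noncomputable def mk2d {P₁ P₀ : ModuleCat.{u} A} (f : P₁ ⟶ P₀) : ∀ i j : ℤ, mk2X P₁ P₀ i ⟶ mk2X P₁ P₀ j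
  | Int.negSucc 0, Int.ofNat 0 => f
  | _, _ => 0

theorem mk2X_zero (P₁ P₀ : ModuleCat.{u} A) (i : ℤ) (h1 : i ≠ -1) (h0 : i ≠ 0) :
    IsZero (mk2X P₁ P₀ i) := by
  have : IsZero (ModuleCat.of A PUnit.{u+1}) := ModuleCat.isZero_of_subsingleton _
  match i, h1, h0 with
  | Int.negSucc 0, h1, _ => exact absurd rfl h1
  | Int.ofNat 0, _, h0 => exact absurd rfl h0
  | Int.negSucc (n+1), _, _ => exact this
  | Int.ofNat (n+1), _, _ => exact this

theorem mk2d_zero {P₁ P₀ : ModuleCat.{u} A} (f : P₁ ⟶ P₀) (i j : ℤ) (h : i ≠ -1 ∨ j ≠ 0) :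
    mk2d f i j = 0 := by
  rcases h with h | h
  · by_cases h0 : i = 0
    · subst h0; rfl
    · exact (mk2X_zero _ _ i h h0).eq_of_src _ _
  · by_cases h0 : j = -1
    · subst h0
      by_cases h1 : i = -1
      · subst h1; rfl
      · by_cases h0 : i = 0
        · subst h0; rfl
        · exact (mk2X_zero _ _ i h1 h0).eq_of_src _ _
    · exact (mk2X_zero _ _ j h0 h).eq_of_tgt _ _

/-- The two-term complex attached to a map. -/
@[reducible] noncomputable def mk2 {P₁ P₀ : ModuleCat.{u} A} (f : P₁ ⟶ P₀) : CochainComplex (ModuleCat.{u} A) ℤ where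
  X := mk2X P₁ P₀
  d := mk2d f
  shape i j h := mk2d_zero f i j (by
    by_contra hc
    push Not at hc
    apply h
    rw [hc.1, hc.2]
    simp)
  d_comp_d' i j l _ _ := by
    by_cases h : j = 0
    · rw [mk2d_zero f j l (Or.inl (by omega)), comp_zero]
    · rw [mk2d_zero f i j (Or.inr h), zero_comp]

/-- Families of maps indexed by the integers supported at `-1` and `0`. -/
noncomputable def mkFam {X Y : ℤ → ModuleCat.{u} A} (b : X (-1) ⟶ Y (-1)) (a : X 0 ⟶ Y 0) :
    ∀ i : ℤ, X i ⟶ Y i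
  | Int.negSucc 0 => b
  | Int.ofNat 0 => a
  | Int.negSucc (_+1) => 0
  | Int.ofNat (_+1) => 0

/-- Chain maps between complexes, one of which is two-term. -/
noncomputable def mkHom (C D : CochainComplex (ModuleCat.{u} A) ℤ)
    (h : ∀ i, i ≠ -1 → i ≠ 0 → IsZero (C.X i))
    (h' : ∀ i, i ≠ -1 → i ≠ 0 → IsZero (D.X i))
    (b : C.X (-1) ⟶ D.X (-1)) (a : C.X 0 ⟶ D.X 0) (w : b ≫ D.d (-1) 0 = C.d (-1) 0 ≫ a) :
    C ⟶ D where
  f := mkFam b a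
  comm' i j hij := by
    have hij : i + 1 = j := by simpa using hij
    by_cases h1 : i = -1
    · subst h1
      obtain rfl : j = 0 := by omega
      exact w
    · by_cases h0 : i = 0
      · subst h0
        obtain rfl : j = 1 := by omega
        exact (h' 1 (by omega) (by omega)).eq_of_tgt _ _
      · exact (h i h1 h0).eq_of_src _ _

theorem hom_ext_two {C D : CochainComplex (ModuleCat.{u} A) ℤ}
    (h : ∀ i, i ≠ -1 → i ≠ 0 → IsZero (C.X i)) (f g : C ⟶ D)
    (h1 : f.f (-1) = g.f (-1)) (h0 : f.f 0 = g.f 0) : f = g := by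
  ext i : 1
  by_cases hi1 : i = -1
  · subst hi1; exact h1
  · by_cases hi0 : i = 0
    · subst hi0; exact h0
    · exact (h i hi1 hi0).eq_of_src _ _

theorem mk2_zero {P₁ P₀ : ModuleCat.{u} A} (f : P₁ ⟶ P₀) :
    ∀ i, i ≠ -1 → i ≠ 0 → IsZero ((mk2 f).X i) := mk2X_zero P₁ P₀

/-- Two-term complexes are isomorphic to `mk2`. -/
noncomputable def isoMk2 (C : CochainComplex (ModuleCat.{u} A) ℤ)
    (h : ∀ i, i ≠ -1 → i ≠ 0 → IsZero (C.X i)) : C ≅ mk2 (C.d (-1) 0) where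
  hom := mkHom C (mk2 (C.d (-1) 0)) h (mk2_zero _) (𝟙 (C.X (-1))) (𝟙 (C.X 0))
    ((Category.id_comp _).trans (Category.comp_id _).symm)
  inv := mkHom (mk2 (C.d (-1) 0)) C (mk2_zero _) h (𝟙 (C.X (-1))) (𝟙 (C.X 0))
    ((Category.id_comp _).trans (Category.comp_id _).symm)
  hom_inv_id := hom_ext_two h _ _ (Category.id_comp _) (Category.id_comp _)
  inv_hom_id := hom_ext_two (mk2_zero _) _ _ (Category.id_comp (𝟙 (C.X (-1)))) (Category.id_comp (𝟙 (C.X 0)))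

variable {P₁ P₀ Q₁ Q₀ R₁ R₀ : ModuleCat.{u} A} {f : P₁ ⟶ P₀} {g : Q₁ ⟶ Q₀} {h : R₁ ⟶ R₀}

/-- Chain maps between two-term complexes. -/
noncomputable def mk2Hom (f : P₁ ⟶ P₀) (g : Q₁ ⟶ Q₀) (b : P₁ ⟶ Q₁) (a : P₀ ⟶ Q₀)
    (w : b ≫ g = f ≫ a) : mk2 f ⟶ mk2 g :=
  mkHom _ _ (mk2_zero _) (mk2_zero _) b a w

/-- Degree `-1` component. -/
noncomputable def c1 (φ : mk2 f ⟶ mk2 g) : P₁ ⟶ Q₁ := φ.f (-1)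
/-- Degree `0` component. -/
noncomputable def c0 (φ : mk2 f ⟶ mk2 g) : P₀ ⟶ Q₀ := φ.f 0

theorem c_comm (φ : mk2 f ⟶ mk2 g) : c1 φ ≫ g = f ≫ c0 φ := φ.comm (-1) 0

@[simp] theorem c1_mk (b : P₁ ⟶ Q₁) (a : P₀ ⟶ Q₀) (w : b ≫ g = f ≫ a) :
    c1 (mk2Hom f g b a w) = b := rfl
@[simp] theorem c0_mk (b : P₁ ⟶ Q₁) (a : P₀ ⟶ Q₀) (w : b ≫ g = f ≫ a) :
    c0 (mk2Hom f g b a w) = a := rfl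
@[simp] theorem c1_comp (φ : mk2 f ⟶ mk2 g) (ψ : mk2 g ⟶ mk2 h) : c1 (φ ≫ ψ) = c1 φ ≫ c1 ψ := rfl
@[simp] theorem c0_comp (φ : mk2 f ⟶ mk2 g) (ψ : mk2 g ⟶ mk2 h) : c0 (φ ≫ ψ) = c0 φ ≫ c0 ψ := rfl
@[simp] theorem c1_id : c1 (𝟙 (mk2 f)) = 𝟙 P₁ := rfl
@[simp] theorem c0_id : c0 (𝟙 (mk2 f)) = 𝟙 P₀ := rfl
@[simp] theorem c1_add (φ ψ : mk2 f ⟶ mk2 g) : c1 (φ + ψ) = c1 φ + c1 ψ := rfl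
@[simp] theorem c0_add (φ ψ : mk2 f ⟶ mk2 g) : c0 (φ + ψ) = c0 φ + c0 ψ := rfl

theorem mk2_ext (φ ψ : mk2 f ⟶ mk2 g) (h1 : c1 φ = c1 ψ) (h0 : c0 φ = c0 ψ) : φ = ψ :=
  hom_ext_two (mk2_zero _) _ _ h1 h0

theorem mk2_finite (h1 : Module.Finite A P₁) (h0 : Module.Finite A P₀) (f : P₁ ⟶ P₀) (i : ℤ) :
    Module.Finite A ((mk2 f).X i) := by
  match i with
  | Int.negSucc 0 => exact h1
  | Int.ofNat 0 => exact h0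
  | Int.negSucc (n+1) => exact inferInstanceAs (Module.Finite A PUnit.{u+1})
  | Int.ofNat (n+1) => exact inferInstanceAs (Module.Finite A PUnit.{u+1})

theorem mk2_fd (k : Type) [Field k] [Algebra k A] [FiniteDimensional k A]
    (f : P₁ ⟶ P₀) (g : Q₁ ⟶ Q₀) (h1 : Module.Finite A P₁) (h0 : Module.Finite A P₀)
    (hQ1 : Module.Finite A Q₁) (hQ0 : Module.Finite A Q₀) :
    FiniteDimensional k (mk2 f ⟶ mk2 g) :=
  fd_hom_complex k _ _ (-1) 0 (fun i hi => mk2_zero _ i (by omega) (by omega))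
    (mk2_finite h1 h0 f) (mk2_finite hQ1 hQ0 g)

/-- Null-homotopic chain maps between two-term complexes. -/
theorem mk2_map_eq_zero_iff (φ : mk2 f ⟶ mk2 g) :
    (Qf.{u} A).map φ = 0 ↔ ∃ s : P₀ ⟶ Q₁, c1 φ = f ≫ s ∧ c0 φ = s ≫ g := by
  rw [HomotopyCategory.quotient_map_eq_zero_iff]
  constructor
  · rintro ⟨H⟩
    refine ⟨H.hom 0 (-1), ?_, ?_⟩
    · have := H.comm (-1)
      rw [dNext_eq _ (i := -1) (i' := 0) (by simp), prevD_eq _ (j := -1) (j' := -2) (by simp)] at this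
      rw [(mk2_zero g (-2) (by decide) (by decide)).eq_of_tgt (H.hom (-1) (-2)) 0,
        zero_comp, add_zero, HomologicalComplex.zero_f, add_zero] at this
      exact this
    · have := H.comm 0
      rw [dNext_eq _ (i := 0) (i' := 1) (by simp), prevD_eq _ (j := 0) (j' := -1) (by simp)] at this
      rw [(mk2_zero f 1 (by decide) (by decide)).eq_of_src (H.hom 1 0) 0,
        comp_zero, zero_add, HomologicalComplex.zero_f, add_zero] at this
      exact this
  · rintro ⟨s, h1, h0⟩
    let hh : ∀ i j : ℤ, (ComplexShape.up ℤ).Rel j i → ((mk2 f).X i ⟶ (mk2 g).X j) := fun i j _ =>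
      if h : i = 0 ∧ j = -1 then eqToHom (by rw [h.1]; rfl) ≫ s ≫ eqToHom (by rw [h.2]; rfl) else 0
    have : φ = Homotopy.nullHomotopicMap' hh := by
      refine hom_ext_two (mk2_zero _) _ _ ?_ ?_
      · have r1 : (ComplexShape.up ℤ).Rel (-2) (-1) := by simp
        rw [Homotopy.nullHomotopicMap'_f (k₂ := -2) (k₁ := -1) (k₀ := 0) r1 (by simp)]
        rw [(mk2_zero g (-2) (by decide) (by decide)).eq_of_tgt (hh (-1) (-2) _) 0, zero_comp, add_zero]
        have : hh 0 (-1) (by simp) = s := by simp [hh]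
        rw [this]
        · exact h1
        · exact r1
      · have r1 : (ComplexShape.up ℤ).Rel 0 1 := by simp
        rw [Homotopy.nullHomotopicMap'_f (k₂ := -1) (k₁ := 0) (k₀ := 1) (by simp) r1]
        rw [(mk2_zero f 1 (by decide) (by decide)).eq_of_src (hh 1 0 _) 0, comp_zero, zero_add]
        have : hh 0 (-1) (by simp) = s := by simp [hh]
        rw [this]
        · exact h0
        · exact r1
    rw [this]
    exact ⟨Homotopy.nullHomotopy' hh⟩

/-- Algebraic vanishing of `Hom(f, g[1])`. -/
def Ext0 (f : P₁ ⟶ P₀) (g : Q₁ ⟶ Q₀) : Prop :=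
  ∀ c : P₁ ⟶ Q₀, ∃ (a : P₀ ⟶ Q₀) (b : P₁ ⟶ Q₁), c = f ≫ a + b ≫ g

theorem shift_X_zero (C : CochainComplex (ModuleCat.{u} A) ℤ)
    (h : ∀ i, i ≠ -1 → i ≠ 0 → IsZero (C.X i)) :
    ∀ i : ℤ, i ≠ -2 → i ≠ -1 → IsZero ((C⟦(1 : ℤ)⟧).X i) := by
  intro i h1 h0
  exact h (i+1) (by omega) (by omega)

theorem shift_d_iso (C : CochainComplex (ModuleCat.{u} A) ℤ) (i j i' j' : ℤ) (hi : i' = i + 1)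
    (hj : j' = j + 1) :
    (C⟦(1 : ℤ)⟧).d i j ≫ (CochainComplex.shiftFunctorObjXIso C 1 j j' hj).hom =
      - (CochainComplex.shiftFunctorObjXIso C 1 i i' hi).hom ≫ C.d i' j' := by
  subst hi hj
  simp [CochainComplex.shiftFunctorObjXIso, CochainComplex.shiftFunctor_obj_d']
  erw [Category.id_comp]
  rfl

theorem ext0_of_hom_zero (f : P₁ ⟶ P₀) (g : Q₁ ⟶ Q₀)
    (H : ∀ t : (Qf.{u} A).obj (mk2 f) ⟶ ((Qf.{u} A).obj (mk2 g))⟦(1 : ℤ)⟧, t = 0) : Ext0 f g := by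
  intro c
  have hz := shift_X_zero (mk2 g) (mk2_zero g)
  let s0 := CochainComplex.shiftFunctorObjXIso (mk2 g) 1 (-1) 0 (by simp)
  let s1 := CochainComplex.shiftFunctorObjXIso (mk2 g) 1 (-2) (-1) (by simp)
  let c' : (mk2 f).X (-1) ⟶ (mk2 g).X 0 := c
  let φ : mk2 f ⟶ (mk2 g)⟦(1 : ℤ)⟧ :=
    { f := mkFam (X := (mk2 f).X) (Y := ((mk2 g)⟦(1 : ℤ)⟧).X) (c' ≫ s0.inv) 0
      comm' := by
        intro i j hij
        have hij : i + 1 = j := by simpa using hij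
        by_cases h1 : i = -1 ∨ i = 0
        · exact (hz j (by omega) (by omega)).eq_of_tgt _ _
        · exact (mk2_zero f i (by omega) (by omega)).eq_of_src _ _ }
  have h0 : (Qf.{u} A).map φ = 0 := by
    have := H ((Qf.{u} A).map φ ≫ ((Qf.{u} A).commShiftIso (1 : ℤ)).hom.app (mk2 g))
    rwa [← cancel_mono (((Qf.{u} A).commShiftIso (1 : ℤ)).hom.app (mk2 g)), zero_comp]
  rw [HomotopyCategory.quotient_map_eq_zero_iff] at h0
  obtain ⟨H⟩ := h0
  have := H.comm (-1)
  rw [dNext_eq _ (i := -1) (i' := 0) (by simp), prevD_eq _ (j := -1) (j' := -2) (by simp),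
    HomologicalComplex.zero_f, add_zero] at this
  let a : (mk2 f).X 0 ⟶ (mk2 g).X 0 := H.hom 0 (-1) ≫ s0.hom
  let b : (mk2 f).X (-1) ⟶ (mk2 g).X (-1) := H.hom (-1) (-2) ≫ s1.hom
  refine ⟨a, -b, ?_⟩
  have e1 : φ.f (-1) ≫ s0.hom = c' := by
    change (c' ≫ s0.inv) ≫ s0.hom = c'
    rw [Category.assoc, Iso.inv_hom_id, Category.comp_id]
  have e2 : (mk2 f).d (-1) 0 ≫ a + (-b) ≫ (mk2 g).d (-1) 0 = c' := by
    rw [← e1, this, Preadditive.add_comp, Category.assoc, Category.assoc,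
      shift_d_iso (mk2 g) (-2) (-1) (-1) 0 (by simp) (by simp)]
    simp only [a, b, Preadditive.neg_comp, Preadditive.comp_neg, Category.assoc]
    rfl
  exact e2.symm

end Mk2

section Thick

variable {A : Type} [Ring A]

theorem exists_free (X : Type u) [AddCommGroup X] [Module A X] [Module.Finite A X]
    [Module.Projective A X] : ∃ (r : ℕ) (p : (Fin r → ULift.{u} A) →ₗ[A] X)
      (s : X →ₗ[A] (Fin r → ULift.{u} A)), p ∘ₗ s = LinearMap.id := by
  obtain ⟨r, p, s, hp, hs, hps⟩ := Module.Finite.exists_comp_eq_id_of_projective A X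
  let e : (Fin r → ULift.{u} A) ≃ₗ[A] (Fin r → A) :=
    LinearEquiv.piCongrRight fun _ => ULift.moduleEquiv
  refine ⟨r, p ∘ₗ e.toLinearMap, e.symm.toLinearMap ∘ₗ s, ?_⟩
  refine LinearMap.ext fun x => ?_
  change p (e (e.symm (s x))) = x
  rw [e.apply_symm_apply]
  exact congrArg (fun t => t x) hps

/-- The closure conditions defining thick subcategories. -/
structure ThickSet (S : Set (Kb.{u} A)) : Prop where
  iso : ∀ Y Z : Kb.{u} A, (Y ≅ Z) → Y ∈ S → Z ∈ S
  shift : ∀ Y : Kb.{u} A, Y ∈ S → Y⟦(1 : ℤ)⟧ ∈ S ∧ Y⟦(-1 : ℤ)⟧ ∈ S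
  cone : ∀ T : Triangle (Kb.{u} A), (T ∈ distTriang (Kb.{u} A)) →
      T.obj₁ ∈ S → T.obj₂ ∈ S → T.obj₃ ∈ S
  summand : ∀ Y Z : Kb.{u} A, IsSummandOf Y Z → Z ∈ S → Y ∈ S

namespace ThickSet

variable {S : Set (Kb.{u} A)}

theorem ext2 (hS : ThickSet S) (T : Triangle (Kb.{u} A)) (hT : T ∈ distTriang (Kb.{u} A)) (h1 : T.obj₁ ∈ S)
    (h3 : T.obj₃ ∈ S) : T.obj₂ ∈ S :=
  hS.cone _ (inv_rot_of_distTriang _ hT) (hS.shift _ h3).2 h1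

theorem ext1 (hS : ThickSet S) (T : Triangle (Kb.{u} A)) (hT : T ∈ distTriang (Kb.{u} A)) (h2 : T.obj₂ ∈ S)
    (h3 : T.obj₃ ∈ S) : T.obj₁ ∈ S := by
  have h := hS.cone _ (rot_of_distTriang _ hT) h2 h3
  exact hS.iso _ _ ((shiftFunctorCompIsoId (Kb.{u} A) (1 : ℤ) (-1) (by simp)).app T.obj₁)
    (hS.shift _ h).2

theorem zero_mem (hS : ThickSet S) {Y : Kb.{u} A} (hY : Y ∈ S) {Z : Kb.{u} A} (hZ : IsZero Z) : Z ∈ S :=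
  hS.summand Z Y ⟨0, 0, hZ.eq_of_src _ _⟩ hY

theorem biprod_mem (hS : ThickSet S) {Y Z : Kb.{u} A} (hY : Y ∈ S) (hZ : Z ∈ S) : (Y ⊞ Z) ∈ S :=
  hS.ext2 _ (binaryBiproductTriangle_distinguished Y Z) hY hZ

theorem sum_mem (hS : ThickSet S) {ι : Type*} (s : Finset ι) {Y : Kb.{u} A} {Z : ι → Kb.{u} A} (hZ : ∀ i, Z i ∈ S)
    (h0 : ∃ X, X ∈ S)
    (a : ∀ i, Y ⟶ Z i) (b : ∀ i, Z i ⟶ Y) (h : ∑ i ∈ s, a i ≫ b i = 𝟙 Y) : Y ∈ S := by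
  classical
  have : ∀ s : Finset ι, ∃ W ∈ S, ∃ (a' : Y ⟶ W) (b' : W ⟶ Y), ∑ i ∈ s, a i ≫ b i = a' ≫ b' := by
    intro s
    induction s using Finset.induction_on with
    | empty =>
      obtain ⟨X, hX⟩ := h0
      exact ⟨X, hX, 0, 0, by simp⟩
    | insert j s hj ih =>
      obtain ⟨W, hW, a', b', e⟩ := ih
      refine ⟨W ⊞ Z j, hS.biprod_mem hW (hZ j), biprod.lift a' (a j), biprod.desc b' (b j), ?_⟩
      rw [Finset.sum_insert hj, e, biprod.lift_desc, add_comm]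
  obtain ⟨W, hW, a', b', e⟩ := this s
  exact hS.summand Y W ⟨a', b', by rw [← e, h]⟩ hW

theorem degreewise (hS : ThickSet S) (C : ShortComplex (CochainComplex (ModuleCat.{u} A) ℤ))
    (σ : ∀ n, (C.map (HomologicalComplex.eval _ _ n)).Splitting) :
    ((Qf.{u} A).obj C.X₁ ∈ S → (Qf.{u} A).obj C.X₃ ∈ S → (Qf.{u} A).obj C.X₂ ∈ S) ∧
    ((Qf.{u} A).obj C.X₂ ∈ S → (Qf.{u} A).obj C.X₃ ∈ S → (Qf.{u} A).obj C.X₁ ∈ S) := by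
  have h : CochainComplex.trianglehOfDegreewiseSplit C σ ∈ distTriang (Kb.{u} A) :=
    (HomotopyCategory.distinguished_iff_iso_trianglehOfDegreewiseSplit _).2 ⟨C, σ, ⟨Iso.refl _⟩⟩
  exact ⟨hS.ext2 _ h, hS.ext1 _ h⟩

theorem single_mem (hS : ThickSet S) (X : ModuleCat.{u} A)
    (h : (Qf.{u} A).obj ((CochainComplex.singleFunctor (ModuleCat.{u} A) 0).obj X) ∈ S) (n : ℤ) :
    (Qf.{u} A).obj ((CochainComplex.singleFunctor (ModuleCat.{u} A) n).obj X) ∈ S := by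
  have up : ∀ m a a' : ℤ, (m = 1 ∨ m = -1) → ∀ h : m + a = a',
      (Qf.{u} A).obj ((CochainComplex.singleFunctor (ModuleCat.{u} A) a').obj X) ∈ S →
      (Qf.{u} A).obj ((CochainComplex.singleFunctor (ModuleCat.{u} A) a).obj X) ∈ S := by
    intro m a a' hm h hX
    refine hS.iso _ _ ((((Qf.{u} A).commShiftIso m).app _).symm ≪≫
      (Qf.{u} A).mapIso (((CochainComplex.singleFunctors (ModuleCat.{u} A)).shiftIso m a a' h).app X)) ?_
    rcases hm with rfl | rfl
    · exact (hS.shift _ hX).1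
    · exact (hS.shift _ hX).2
  induction n using Int.induction_on with
  | zero => exact h
  | succ i ih => exact up (-1) _ _ (Or.inr rfl) (by ring) ih
  | pred i ih => exact up 1 _ _ (Or.inl rfl) (by ring) ih

theorem single_proj_mem (hS : ThickSet S)
    (h : (Qf.{u} A).obj ((CochainComplex.singleFunctor (ModuleCat.{u} A) 0).obj (ModuleCat.of A (ULift.{u} A))) ∈ S)
    (X : ModuleCat.{u} A) (hX : Projective X) (hf : Module.Finite A X) (n : ℤ) :
    (Qf.{u} A).obj ((CochainComplex.singleFunctor (ModuleCat.{u} A) n).obj X) ∈ S := by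
  apply hS.single_mem
  haveI : Module.Projective A X := (IsProjective.iff_projective X).2 hX
  obtain ⟨r, p, s, hps⟩ := exists_free.{u} (A := A) X
  let F : ModuleCat.{u} A ⥤ Kb.{u} A := CochainComplex.singleFunctor (ModuleCat.{u} A) 0 ⋙ Qf.{u} A
  haveI : F.Additive := by dsimp [F]; infer_instance
  have h2 : F.obj (ModuleCat.of A (Fin r → ULift.{u} A)) ∈ S := by
    refine hS.sum_mem (Finset.univ : Finset (Fin r)) (Z := fun _ => F.obj (ModuleCat.of A (ULift.{u} A)))
      (fun _ => h) ⟨_, h⟩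
      (fun i => F.map (ModuleCat.ofHom (LinearMap.proj i)))
      (fun i => F.map (ModuleCat.ofHom (LinearMap.single A (fun _ => ULift.{u} A) i))) ?_
    simp only [← Functor.map_comp, ← Functor.map_sum]
    rw [← CategoryTheory.Functor.map_id]
    congr 1
    ext v
    simp
  refine hS.summand _ _ ⟨F.map (ModuleCat.ofHom s), F.map (ModuleCat.ofHom p), ?_⟩ h2
  rw [← Functor.map_comp, ← ModuleCat.ofHom_comp, hps]
  exact F.map_id X


theorem bounded_mem (hS : ThickSet S)
    (h : (Qf.{u} A).obj ((CochainComplex.singleFunctor (ModuleCat.{u} A) 0).obj (ModuleCat.of A (ULift.{u} A))) ∈ S)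
    (w : ℕ) : ∀ (C : CochainComplex (ModuleCat.{u} A) ℤ) (a b : ℤ), b < a + w →
      (∀ i : ℤ, (i < a ∨ b < i) → IsZero (C.X i)) →
      (∀ i : ℤ, Projective (C.X i) ∧ Module.Finite A (C.X i)) → (Qf.{u} A).obj C ∈ S := by
  induction w with
  | zero =>
    intro C a b hab hz _
    apply hS.zero_mem h
    have : IsZero C := by
      rw [IsZero.iff_id_eq_zero]
      ext i : 1
      exact (hz i (by omega)).eq_of_src _ _
    exact (Qf.{u} A).map_isZero this
  | succ w ih =>
    intro C a b hab hz hp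
    let π : C ⟶ (CochainComplex.singleFunctor (ModuleCat.{u} A) a).obj (C.X a) :=
      HomologicalComplex.mkHomToSingle (𝟙 (C.X a)) (by
        intro i hi
        have hi : i + 1 = a := by simpa using hi
        exact (hz i (Or.inl (by omega))).eq_of_src _ _)
    have hiso : IsIso (π.f a) := by
      simp only [π, HomologicalComplex.mkHomToSingle_f, Category.id_comp]
      exact Iso.isIso_inv _
    have hsz : ∀ i, i ≠ a →
        IsZero (((CochainComplex.singleFunctor (ModuleCat.{u} A) a).obj (C.X a)).X i) := by
      intro i hi
      exact HomologicalComplex.isZero_single_obj_X _ _ _ _ hi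
    haveI : ∀ i, Epi (π.f i) := by
      intro i
      by_cases hi : i = a
      · subst hi; infer_instance
      · exact ⟨fun _ _ _ => (hsz i hi).eq_of_src _ _⟩
    haveI : Epi π := HomologicalComplex.epi_of_epi_f _ inferInstance
    let T : ShortComplex (CochainComplex (ModuleCat.{u} A) ℤ) :=
      ShortComplex.mk (kernel.ι π) π (kernel.condition π)
    have hT : T.ShortExact :=
      { exact := ShortComplex.exact_of_f_is_kernel _ (kernelIsKernel π)
        mono_f := inferInstanceAs (Mono (kernel.ι π))
        epi_g := inferInstanceAs (Epi π) }
    have hp3 : ∀ n, Projective (T.X₃.X n) := by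
      intro n
      by_cases hn : n = a
      · subst hn
        exact Projective.of_iso (asIso (π.f n)) (hp n).1
      · exact (hsz n hn).projective
    have hTn : ∀ n, (T.map (HomologicalComplex.eval _ _ n)).ShortExact :=
      fun n => hT.map_of_exact _
    let σ : ∀ n, (T.map (HomologicalComplex.eval (ModuleCat.{u} A) (ComplexShape.up ℤ) n)).Splitting := fun n => by
      haveI : Projective (T.map (HomologicalComplex.eval (ModuleCat.{u} A) (ComplexShape.up ℤ) n)).X₃ := hp3 n
      exact (hTn n).splittingOfProjective
    refine (hS.degreewise T σ).1 ?_ (hS.single_proj_mem h _ (hp a).1 (hp a).2 a)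
    have hret : ∀ n, (T.f.f n) ≫ (σ n).r = 𝟙 (T.X₁.X n) := fun n => (σ n).f_r
    refine ih T.X₁ (a+1) b (by push_cast at hab; omega) ?_ ?_
    · intro i hi
      by_cases hi' : i = a
      · subst hi'
        rw [IsZero.iff_id_eq_zero, ← hret]
        have : T.f.f i ≫ π.f i = 0 := by
          have := congrArg (fun t => HomologicalComplex.Hom.f t i) T.zero
          exact this
        have : T.f.f i = 0 := by
          rw [← cancel_mono (π.f i), this, zero_comp]
        rw [this]
        exact zero_comp
      · exact isZero_of_retract _ _ (hret i) (hz i (by omega))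
    · intro i
      exact ⟨projective_of_retract _ _ (hret i) (hp i).1, finite_of_retract _ _ (hret i) (hp i).2⟩

theorem inKbProj_mem (hS : ThickSet S)
    (h : (Qf.{u} A).obj ((CochainComplex.singleFunctor (ModuleCat.{u} A) 0).obj (ModuleCat.of A (ULift.{u} A))) ∈ S)
    (X : Kb.{u} A) (hX : inKbProj X) : X ∈ S := by
  obtain ⟨C, ⟨a, b, hz⟩, hp, ⟨e⟩⟩ := hX
  exact hS.iso _ _ e (hS.bounded_mem h (b + 1 - a).toNat C a b (by omega) hz hp)

end ThickSet

theorem thickSet_inKbProj (k : Type) [Field k] [Algebra k A] [FiniteDimensional k A] :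
    ThickSet {X : Kb.{u} A | inKbProj X} where
  iso := by
    rintro Y Z e ⟨C, h1, h2, ⟨e'⟩⟩
    exact ⟨C, h1, h2, ⟨e' ≪≫ e⟩⟩
  shift := by
    have : ∀ (n : ℤ) (Y : Kb.{u} A), inKbProj Y → inKbProj (Y⟦n⟧) := by
      rintro n Y ⟨C, ⟨a, b, h1⟩, h2, ⟨e⟩⟩
      refine ⟨C⟦n⟧, ⟨a - n, b - n, fun i hi => h1 (i + n) (by omega)⟩, fun i => h2 (i + n),
        ⟨((Qf.{u} A).commShiftIso n).app C ≪≫ (shiftFunctor _ n).mapIso e⟩⟩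
    exact fun Y hY => ⟨this 1 Y hY, this (-1) Y hY⟩
  cone := by
    rintro T hT ⟨C, ⟨a, b, h1⟩, h2, ⟨e⟩⟩ ⟨D, ⟨a', b', h1'⟩, h2', ⟨e'⟩⟩
    obtain ⟨φ, hφ⟩ := (Qf.{u} A).map_surjective (e.hom ≫ T.mor₁ ≫ e'.inv)
    have hT' := HomotopyCategory.mappingCone_triangleh_distinguished φ
    let E := isoTriangleOfIso₁₂ _ _ hT' hT e e' (by
      change (Qf.{u} A).map φ ≫ e'.hom = e.hom ≫ T.mor₁
      rw [hφ]; simp)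
    have X : ∀ i, (CochainComplex.mappingCone φ).X i ≅ C.X (i+1) ⊞ D.X i := fun i =>
      HomologicalComplex.homotopyCofiber.XIsoBiprod φ i (i+1) (by simp)
    refine ⟨CochainComplex.mappingCone φ, ⟨min (a - 1) a', max b b', ?_⟩, ?_, ⟨Triangle.π₃.mapIso E⟩⟩
    · intro i hi
      refine IsZero.of_iso ?_ (X i)
      have z1 := h1 (i+1) (by omega)
      have z2 := h1' i (by omega)
      rw [IsZero.iff_id_eq_zero]
      exact biprod.hom_ext' _ _ (z1.eq_of_src _ _) (z2.eq_of_src _ _)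
    · intro i
      haveI := (h2 (i+1)).1
      haveI := (h2' i).1
      haveI := (h2 (i+1)).2
      haveI := (h2' i).2
      refine ⟨Projective.of_iso (X i).symm inferInstance, ?_⟩
      have : Module.Finite A (ModuleCat.of A (C.X (i+1) × D.X i)) :=
        inferInstanceAs (Module.Finite A (C.X (i+1) × D.X i))
      exact finite_of_retract (X i ≪≫ ModuleCat.biprodIsoProd _ _).hom (X i ≪≫ ModuleCat.biprodIsoProd _ _).inv
        (Iso.hom_inv_id _) this
  summand := by
    rintro Y Z ⟨i, r, hir⟩ ⟨C, ⟨a, b, h1⟩, h2, ⟨e⟩⟩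
    haveI := fd_hom_complex k C C a b h1 (fun i => (h2 i).2) (fun i => (h2 i).2)
    obtain ⟨T, ι, π, h, ⟨e'⟩⟩ := split_retract k C Y (i ≫ e.inv) (e.hom ≫ r) (by simpa using hir)
    have hi : ∀ i, ι.f i ≫ π.f i = 𝟙 _ := by
      intro i
      rw [← HomologicalComplex.comp_f, h, HomologicalComplex.id_f]
    exact ⟨T, ⟨a, b, fun i hi' => isZero_of_retract _ _ (hi i) (h1 i hi')⟩,
      fun i => ⟨projective_of_retract _ _ (hi i) (h2 i).1, finite_of_retract _ _ (hi i) (h2 i).2⟩, ⟨e'⟩⟩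

end Thick

section Two

variable {A : Type} [Ring A]

/-- Two-term complexes of finitely generated projective modules. -/
structure Two (A : Type) [Ring A] where
  /-- degree -1 -/
  P1 : ModuleCat.{u} A
  /-- degree 0 -/
  P0 : ModuleCat.{u} A
  /-- differential -/
  f : P1 ⟶ P0
  fin1 : Module.Finite A P1
  fin0 : Module.Finite A P0
  proj1 : Projective P1
  proj0 : Projective P0

namespace Two

/-- The associated cochain complex. -/
noncomputable abbrev C (X : Two.{u} A) : CochainComplex (ModuleCat.{u} A) ℤ := mk2 X.f

/-- The associated object of the homotopy category. -/
noncomputable abbrev K (X : Two.{u} A) : Kb.{u} A := (Qf.{u} A).obj X.C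

/-- Chain-level retracts. -/
def Ret (X Y : Two.{u} A) : Prop := ∃ (ι : X.C ⟶ Y.C) (π : Y.C ⟶ X.C), ι ≫ π = 𝟙 X.C

theorem Ret.trans {X Y Z : Two.{u} A} (h : Ret X Y) (h' : Ret Y Z) : Ret X Z := by
  obtain ⟨ι, π, h⟩ := h
  obtain ⟨ι', π', h'⟩ := h'
  exact ⟨ι ≫ ι', π' ≫ π, by simp only [Category.assoc]; rw [reassoc_of% h', h]⟩

/-- Vanishing of `Hom(X, Y[1])`. -/
def E (X Y : Two.{u} A) : Prop := Ext0 X.f Y.f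

theorem E.left {X X' Y : Two.{u} A} (h : Ret X X') (hE : E X' Y) : E X Y := by
  obtain ⟨ι, π, h⟩ := h
  have h1 : c1 ι ≫ c1 π = 𝟙 _ := by rw [← c1_comp, h, c1_id]
  intro c
  obtain ⟨a, b, e⟩ := hE (c1 π ≫ c)
  refine ⟨c0 ι ≫ a, c1 ι ≫ b, ?_⟩
  have := congrArg (fun t => c1 ι ≫ t) e
  simp only [reassoc_of% h1, Preadditive.comp_add] at this
  rw [this, ← Category.assoc, c_comm]
  simp only [Category.assoc]

theorem E.right {X X' Y : Two.{u} A} (h : Ret X X') (hE : E Y X') : E Y X := by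
  obtain ⟨ι, π, h⟩ := h
  have h1 : c0 ι ≫ c0 π = 𝟙 _ := by rw [← c0_comp, h, c0_id]
  intro c
  obtain ⟨a, b, e⟩ := hE (c ≫ c0 ι)
  refine ⟨a ≫ c0 π, b ≫ c1 π, ?_⟩
  have := congrArg (fun t => t ≫ c0 π) e
  simp only [Category.assoc, h1, Preadditive.add_comp, Category.comp_id] at this
  rw [this, Category.assoc, c_comm]

/-- A two-term complex in `Two.{u} A`. -/
noncomputable def ofC (C : CochainComplex (ModuleCat.{u} A) ℤ)
    (hp : ∀ i, Projective (C.X i)) (hf : ∀ i, Module.Finite A (C.X i)) : Two.{u} A :=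
  ⟨C.X (-1), C.X 0, C.d (-1) 0, hf _, hf _, hp _, hp _⟩

/-- A two-term complex in `Two.{u} A`. -/
noncomputable def ofCIso (C : CochainComplex (ModuleCat.{u} A) ℤ)
    (hz : ∀ i, i ≠ -1 → i ≠ 0 → IsZero (C.X i))
    (hp : ∀ i, Projective (C.X i)) (hf : ∀ i, Module.Finite A (C.X i)) : C ≅ (ofC C hp hf).C :=
  isoMk2 C hz

theorem finC (X : Two.{u} A) (i : ℤ) : Module.Finite A (X.C.X i) := mk2_finite X.fin1 X.fin0 X.f i

theorem projC (X : Two.{u} A) (i : ℤ) : Projective (X.C.X i) := by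
  by_cases h1 : i = -1
  · subst h1; exact X.proj1
  · by_cases h0 : i = 0
    · subst h0; exact X.proj0
    · exact (mk2_zero X.f i h1 h0).projective

theorem of_retract (X : Two.{u} A) (T : CochainComplex (ModuleCat.{u} A) ℤ) (ι : T ⟶ X.C)
    (π : X.C ⟶ T) (h : ι ≫ π = 𝟙 T) : ∃ (Y : Two.{u} A), Nonempty (T ≅ Y.C) := by
  have hi : ∀ i, ι.f i ≫ π.f i = 𝟙 _ := by
    intro i
    rw [← HomologicalComplex.comp_f, h, HomologicalComplex.id_f]
  exact ⟨ofC T (fun i => projective_of_retract _ _ (hi i) (X.projC i))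
    (fun i => finite_of_retract _ _ (hi i) (X.finC i)),
    ⟨ofCIso T (fun i h1 h0 => isZero_of_retract _ _ (hi i) (mk2_zero X.f i h1 h0)) _ _⟩⟩

variable (k : Type) [Field k] [Algebra k A] [FiniteDimensional k A]

theorem fdC (X Y : Two.{u} A) : FiniteDimensional k (X.C ⟶ Y.C) :=
  mk2_fd k _ _ X.fin1 X.fin0 Y.fin1 Y.fin0

theorem fdK (X Y : Two.{u} A) : FiniteDimensional k (X.K ⟶ Y.K) := by
  haveI := fdC k X Y
  exact fd_hom_K k _ _

theorem split_idem (k : Type) [Field k] [Algebra k A] [FiniteDimensional k A]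
    (X : Two.{u} A) (e : X.K ⟶ X.K) (he : e ≫ e = e) :
    ∃ (T : Two.{u} A) (ι : T.C ⟶ X.C) (π : X.C ⟶ T.C), ι ≫ π = 𝟙 _ ∧ (Qf.{u} A).map (π ≫ ι) = e := by
  haveI := fdC k X X
  obtain ⟨T, ι, π, h1, h2⟩ := _root_.split_idem k X.C e he
  obtain ⟨Y, ⟨φ⟩⟩ := of_retract X T ι π h1
  exact ⟨Y, φ.inv ≫ ι, π ≫ φ.hom, by simp [reassoc_of% h1], by simpa using h2⟩

theorem of_summand (k : Type) [Field k] [Algebra k A] [FiniteDimensional k A]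
    (X : Two.{u} A) (N : Kb.{u} A) (h : IsSummandOf N X.K) :
    ∃ T : Two.{u} A, Ret T X ∧ Nonempty (T.K ≅ N) := by
  haveI := fdC k X X
  obtain ⟨i, r, h⟩ := h
  obtain ⟨T, ι, π, h1, ⟨e⟩⟩ := split_retract k X.C N i r h
  obtain ⟨Y, ⟨φ⟩⟩ := of_retract X T ι π h1
  exact ⟨Y, ⟨φ.inv ≫ ι, π ≫ φ.hom, by simp [reassoc_of% h1]⟩, ⟨(Qf.{u} A).mapIso φ.symm ≪≫ e⟩⟩

theorem Ret.summand {X Y : Two.{u} A} (h : Ret X Y) : IsSummandOf X.K Y.K := by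
  obtain ⟨ι, π, h⟩ := h
  exact ⟨(Qf.{u} A).map ι, (Qf.{u} A).map π, by rw [← Functor.map_comp, h, CategoryTheory.Functor.map_id]⟩

open scoped ModuleCat in
/-- The total dimension. -/
noncomputable def size (X : Two.{u} A) : ℕ := Module.finrank k X.P1 + Module.finrank k X.P0

open scoped ModuleCat in
theorem retract_dim {X Y : ModuleCat.{u} A} (hY : Module.Finite A Y) (i : X ⟶ Y) (r : Y ⟶ X)
    (h : i ≫ r = 𝟙 X) : Module.finrank k X ≤ Module.finrank k Y ∧
      (Module.finrank k X = Module.finrank k Y → r ≫ i = 𝟙 Y) := by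
  haveI := fd_of_finite k Y hY
  haveI := fd_of_finite k X (finite_of_retract i r h hY)
  have hri : ∀ x, r.hom (i.hom x) = x := fun x => congrArg (fun t => t.hom x) h
  let i' : X →ₗ[k] Y := i.hom.restrictScalars k
  have hi : Function.Injective i' := Function.LeftInverse.injective hri
  refine ⟨LinearMap.finrank_le_finrank_of_injective hi, fun he => ?_⟩
  have hs : Function.Surjective i' := (LinearMap.injective_iff_surjective_of_finrank_eq_finrank he).1 hi
  ext y
  obtain ⟨x, rfl⟩ := hs y
  change i.hom (r.hom (i.hom x)) = i.hom x
  rw [hri]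

theorem size_lt {T X : Two.{u} A} (ι : T.C ⟶ X.C) (π : X.C ⟶ T.C) (h : ι ≫ π = 𝟙 _)
    (hne : (Qf.{u} A).map (π ≫ ι) ≠ 𝟙 X.K) : T.size k < X.size k := by
  have h1 := retract_dim k X.fin1 (c1 ι) (c1 π) (by rw [← c1_comp, h, c1_id])
  have h0 := retract_dim k X.fin0 (c0 ι) (c0 π) (by rw [← c0_comp, h, c0_id])
  unfold size
  by_contra hc
  apply hne
  have : π ≫ ι = 𝟙 _ := mk2_ext _ _
    (by rw [c1_comp, c1_id]; exact h1.2 (by omega)) (by rw [c0_comp, c0_id]; exact h0.2 (by omega))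
  rw [this, CategoryTheory.Functor.map_id]

theorem decomp {S : Set (Kb.{u} A)} (hS : ThickSet S) (h0 : ∃ X, X ∈ S) :
    ∀ (n : ℕ) (X : Two.{u} A), X.size k < n → (∀ T : Two.{u} A, Ret T X → Indec T.K → T.K ∈ S) → X.K ∈ S := by
  intro n
  induction n with
  | zero => intro X h; omega
  | succ n ih =>
    intro X hX h
    by_cases hz : IsZero X.K
    · obtain ⟨Y, hY⟩ := h0
      exact hS.zero_mem hY hz
    by_cases hi : Indec X.K
    · exact h X ⟨𝟙 _, 𝟙 _, Category.id_comp _⟩ hi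
    have : ∃ e : X.K ⟶ X.K, e ≫ e = e ∧ e ≠ 0 ∧ e ≠ 𝟙 X.K := by
      by_contra hc
      push Not at hc
      refine hi ⟨hz, fun e he => ?_⟩
      by_cases h0 : e = 0
      · exact Or.inl h0
      · exact Or.inr (hc e he h0)
    obtain ⟨e, he, he0, he1⟩ := this
    have he' : (𝟙 _ - e) ≫ (𝟙 _ - e) = 𝟙 _ - e := by
      simp [Preadditive.sub_comp, Preadditive.comp_sub, he]
    obtain ⟨T, ι, π, h1, h2⟩ := split_idem k X e he
    obtain ⟨T', ι', π', h1', h2'⟩ := split_idem k X _ he'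
    have hT : T.K ∈ S := ih T (by have := size_lt k ι π h1 (by rw [h2]; exact he1); omega)
      (fun U hU => h U (hU.trans ⟨ι, π, h1⟩))
    have hT' : T'.K ∈ S := ih T' (by
        have := size_lt k ι' π' h1' (by
          rw [h2']; intro hc; apply he0
          have : e = 𝟙 _ - (𝟙 _ - e) := by abel
          rw [this, hc, sub_self])
        omega)
      (fun U hU => h U (hU.trans ⟨ι', π', h1'⟩))
    refine hS.summand _ _ ⟨biprod.lift ((Qf.{u} A).map π) ((Qf.{u} A).map π'),
      biprod.desc ((Qf.{u} A).map ι) ((Qf.{u} A).map ι'), ?_⟩ (hS.biprod_mem hT hT')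
    rw [biprod.lift_desc, ← Functor.map_comp, ← Functor.map_comp, h2, h2']
    abel

end Two
end Two

namespace Two

variable {A : Type} [Ring A]

theorem finite_biprod (X Y : ModuleCat.{u} A) (hX : Module.Finite A X) (hY : Module.Finite A Y) :
    Module.Finite A (X ⊞ Y : ModuleCat.{u} A) := by
  have : Module.Finite A (ModuleCat.of A (X × Y)) := inferInstanceAs (Module.Finite A (X × Y))
  exact finite_of_retract (ModuleCat.biprodIsoProd X Y).hom (ModuleCat.biprodIsoProd X Y).inv
    (Iso.hom_inv_id _) this

/-- The extension of `F` by `E` attached to `ψ`. -/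
@[reducible] noncomputable def exten (F E : Two.{u} A) (ψ : F.P1 ⟶ E.P0) : Two.{u} A where
  P1 := E.P1 ⊞ F.P1
  P0 := E.P0 ⊞ F.P0
  f := biprod.desc (E.f ≫ biprod.inl) (ψ ≫ biprod.inl + F.f ≫ biprod.inr)
  fin1 := finite_biprod _ _ E.fin1 F.fin1
  fin0 := finite_biprod _ _ E.fin0 F.fin0
  proj1 := by haveI := E.proj1; haveI := F.proj1; infer_instance
  proj0 := by haveI := E.proj0; haveI := F.proj0; infer_instance

/-- inclusion -/
noncomputable def extenι (F E : Two.{u} A) (ψ : F.P1 ⟶ E.P0) : E.C ⟶ (exten F E ψ).C :=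
  mk2Hom E.f (exten F E ψ).f biprod.inl biprod.inl (by simp [exten])

/-- projection -/
noncomputable def extenπ (F E : Two.{u} A) (ψ : F.P1 ⟶ E.P0) : (exten F E ψ).C ⟶ F.C :=
  mk2Hom (exten F E ψ).f F.f biprod.snd biprod.snd (by
    apply biprod.hom_ext' <;> simp [exten])

/-- The short complex. -/
noncomputable def extenSC (F E : Two.{u} A) (ψ : F.P1 ⟶ E.P0) :
    ShortComplex (CochainComplex (ModuleCat.{u} A) ℤ) :=
  ShortComplex.mk (extenι F E ψ) (extenπ F E ψ)
    (mk2_ext _ _ (biprod.inl_snd) (biprod.inl_snd))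

/-- Its splitting. -/
noncomputable def extenSplit (F E : Two.{u} A) (ψ : F.P1 ⟶ E.P0) (n : ℤ) :
    ((extenSC F E ψ).map (HomologicalComplex.eval _ _ n)).Splitting where
  r := mkFam (X := (exten F E ψ).C.X) (Y := E.C.X) biprod.fst biprod.fst n
  s := mkFam (X := F.C.X) (Y := (exten F E ψ).C.X) biprod.inr biprod.inr n
  f_r := by
    by_cases h1 : n = -1
    · subst h1; exact (biprod.inl_fst : _ = 𝟙 E.P1)
    · by_cases h0 : n = 0
      · subst h0; exact (biprod.inl_fst : _ = 𝟙 E.P0)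
      · exact (mk2_zero E.f n h1 h0).eq_of_src _ _
  s_g := by
    by_cases h1 : n = -1
    · subst h1; exact (biprod.inr_snd : _ = 𝟙 F.P1)
    · by_cases h0 : n = 0
      · subst h0; exact (biprod.inr_snd : _ = 𝟙 F.P0)
      · exact (mk2_zero F.f n h1 h0).eq_of_src _ _
  id := by
    by_cases h1 : n = -1
    · subst h1; exact (biprod.total : _ = 𝟙 (E.P1 ⊞ F.P1))
    · by_cases h0 : n = 0
      · subst h0; exact (biprod.total : _ = 𝟙 (E.P0 ⊞ F.P0))
      · exact (mk2_zero (exten F E ψ).f n h1 h0).eq_of_src _ _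

theorem exten_mem {S : Set (Kb.{u} A)} (hS : ThickSet S) (F E : Two.{u} A) (ψ : F.P1 ⟶ E.P0)
    (h : (exten F E ψ).K ∈ S) (hF : F.K ∈ S) : E.K ∈ S :=
  (hS.degreewise (extenSC F E ψ) (extenSplit F E ψ)).2 h hF

theorem exten_E (F E' : Two.{u} A) (ψ : F.P1 ⟶ E'.P0) (G : Two.{u} A) (h1 : E F G) (h2 : E E' G) :
    E (exten F E' ψ) G := by
  intro (c : E'.P1 ⊞ F.P1 ⟶ G.P0)
  obtain ⟨a, b, e⟩ := h2 (biprod.inl ≫ c)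
  obtain ⟨a2, b2, e2⟩ := h1 (biprod.inr ≫ c - ψ ≫ a)
  refine ⟨(biprod.desc a a2 : E'.P0 ⊞ F.P0 ⟶ G.P0), (biprod.desc b b2 : E'.P1 ⊞ F.P1 ⟶ G.P1), ?_⟩
  apply biprod.hom_ext'
  · simp [exten, e]
  · rw [sub_eq_iff_eq_add] at e2
    simp [exten, e2]
    abel

variable (k : Type) [Field k] [Algebra k A] [FiniteDimensional k A]

/-- Trivial extension classes. -/
noncomputable def B (F E : Two.{u} A) : Submodule k (F.P1 ⟶ E.P0) :=
  LinearMap.range (LinearMap.coprod (Linear.leftComp k E.P0 F.f) (Linear.rightComp k F.P1 E.f))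

theorem mem_B (F E : Two.{u} A) (c : F.P1 ⟶ E.P0) :
    c ∈ B k F E ↔ ∃ (a : F.P0 ⟶ E.P0) (b : F.P1 ⟶ E.P1), c = F.f ≫ a + b ≫ E.f := by
  constructor
  · rintro ⟨⟨a, b⟩, h⟩
    exact ⟨a, b, h.symm⟩
  · rintro ⟨a, b, h⟩
    exact ⟨⟨a, b⟩, h.symm⟩

theorem exten_drop (F E' : Two.{u} A) (hF : E F F) (ψ : F.P1 ⟶ E'.P0) (hψ : ψ ∉ B k F E') :
    Module.finrank k ((F.P1 ⟶ (exten F E' ψ).P0) ⧸ B k F (exten F E' ψ)) <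
    Module.finrank k ((F.P1 ⟶ E'.P0) ⧸ B k F E') := by
  haveI := fd_hom k _ _ F.fin1 E'.fin0
  let φ : (F.P1 ⟶ E'.P0) →ₗ[k] ((F.P1 ⟶ (exten F E' ψ).P0) ⧸ B k F (exten F E' ψ)) :=
    (B k F (exten F E' ψ)).mkQ ∘ₗ
      (Linear.rightComp k F.P1 (biprod.inl : E'.P0 ⟶ E'.P0 ⊞ F.P0))
  have hφ0 : ∀ c, φ c = 0 ↔ ∃ (a : F.P0 ⟶ E'.P0 ⊞ F.P0) (b : F.P1 ⟶ E'.P1 ⊞ F.P1),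
      c ≫ biprod.inl = F.f ≫ a + b ≫ (exten F E' ψ).f := by
    intro c
    rw [← mem_B k F (exten F E' ψ)]
    exact Submodule.Quotient.mk_eq_zero _
  have hsurj : Function.Surjective φ := by
    intro q
    obtain ⟨c', rfl⟩ := Submodule.Quotient.mk_surjective _ q
    let c' : F.P1 ⟶ E'.P0 ⊞ F.P0 := c'
    obtain ⟨a, b, e⟩ := hF (c' ≫ biprod.snd)
    refine ⟨c' ≫ biprod.fst - b ≫ ψ, ?_⟩
    refine (Submodule.Quotient.eq _).2 ?_
    rw [mem_B]
    refine ⟨-(a ≫ biprod.inr), -(b ≫ biprod.inr), ?_⟩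
    change (c' ≫ biprod.fst - b ≫ ψ) ≫ biprod.inl - c' = _
    apply biprod.hom_ext
    · simp [exten]
    · simp [exten, e]; abel
  have hlt : B k F E' < LinearMap.ker φ := by
    refine lt_of_le_of_ne ?_ ?_
    · intro c hc
      obtain ⟨a, b, rfl⟩ := (mem_B k F E' c).1 hc
      refine (hφ0 _).2 ⟨a ≫ biprod.inl, b ≫ biprod.inl, ?_⟩
      simp [exten]
    · intro h
      apply hψ
      rw [h]
      refine (hφ0 _).2 ⟨-biprod.inr, biprod.inr, ?_⟩
      simp [exten]
  have h1 := LinearMap.finrank_range_add_finrank_ker φ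
  rw [LinearMap.range_eq_top.2 hsurj, finrank_top] at h1
  have h2 := Submodule.finrank_quotient_add_finrank (B k F E')
  have h3 := Submodule.finrank_lt_finrank_of_lt hlt
  omega

theorem bongartz (F : Two.{u} A) (hF : E F F) (n : ℕ) : ∀ E' : Two.{u} A,
    Module.finrank k ((F.P1 ⟶ E'.P0) ⧸ B k F E') < n →
    (∀ G, E F G → E E' G) → ∃ E'' : Two.{u} A, E F E'' ∧ (∀ G, E F G → E E'' G) ∧
      ∀ S : Set (Kb.{u} A), ThickSet S → F.K ∈ S → E''.K ∈ S → E'.K ∈ S := by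
  induction n with
  | zero => intro _ h; omega
  | succ n ih =>
    intro E' hn h
    by_cases hB : ∀ ψ, ψ ∈ B k F E'
    · exact ⟨E', fun c => (mem_B k F E' c).1 (hB c), h, fun _ _ _ h => h⟩
    · push Not at hB
      obtain ⟨ψ, hψ⟩ := hB
      obtain ⟨E'', h1, h2, h3⟩ := ih (exten F E' ψ)
        (by have := exten_drop k F E' hF ψ hψ; omega)
        (fun G hG => exten_E F E' ψ G hG (h G hG))
      exact ⟨E'', h1, h2, fun S hS hFS h => exten_mem hS F E' ψ (h3 S hS hFS h) hFS⟩

end Two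

namespace Two

variable {A : Type} [Ring A]

/-- The regular module. -/
noncomputable abbrev AA (A : Type) [Ring A] : ModuleCat.{u} A := ModuleCat.of A (ULift.{u} A)

/-- The generator of the regular module. -/
abbrev one1 (A : Type) [Ring A] : AA.{u} A := (ULift.up (1 : A) : ULift.{u} A)

/-- The map from the regular module given by an element. -/
noncomputable def tsp {M : ModuleCat.{u} A} (m : M) : AA.{u} A ⟶ M :=
  ModuleCat.ofHom (LinearMap.toSpanSingleton A M m ∘ₗ (ULift.moduleEquiv (R := A) (M := A)).toLinearMap)

theorem tsp_apply {M : ModuleCat.{u} A} (m : M) (a : AA.{u} A) : (tsp m).hom a = a.down • m := rfl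

theorem AA_ext {M : ModuleCat.{u} A} (v w : AA.{u} A ⟶ M) (h : v.hom (one1 A) = w.hom (one1 A)) :
    v = w := by
  apply ModuleCat.hom_ext
  refine LinearMap.ext fun a => ?_
  have ha : a = a.down • one1 A := by
    apply ULift.ext
    change a.down = a.down * 1
    rw [mul_one]
  rw [ha, map_smul, map_smul, h]

theorem tsp_comp {M N : ModuleCat.{u} A} (m : M) (h : M ⟶ N) : tsp m ≫ h = tsp (h.hom m) := by
  apply AA_ext
  change h.hom ((1 : A) • m) = (1 : A) • h.hom m
  rw [map_smul]

theorem tsp_one {M : ModuleCat.{u} A} (u : AA.{u} A ⟶ M) : u = tsp (u.hom (one1 A)) := by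
  apply AA_ext
  change u.hom (one1 A) = (1 : A) • u.hom (one1 A)
  rw [one_smul]

theorem cover {P M : ModuleCat.{u} A} (hP : Projective P) (hf : Module.Finite A P)
    (H : AddSubgroup (P ⟶ M)) (Γ : Set M) (hΓ : ∀ m ∈ Γ, ∀ d : P ⟶ AA.{u} A, d ≫ tsp m ∈ H)
    (u : P ⟶ M) (hu : ∀ x : P, u.hom x ∈ Submodule.span A Γ) : u ∈ H := by
  have h1 : ∀ m ∈ Submodule.span A Γ, ∀ d : P ⟶ AA.{u} A, d ≫ tsp m ∈ H := by
    intro m hm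
    induction hm using Submodule.span_induction with
    | mem x h => exact hΓ x h
    | zero =>
      intro d
      have : tsp (0 : M) = 0 := by
        apply AA_ext
        exact smul_zero (1 : A)
      rw [this, comp_zero]
      exact H.zero_mem
    | add x y _ _ hx hy =>
      intro d
      have : tsp (x + y) = tsp x + tsp y := by
        apply AA_ext
        exact smul_add (1 : A) x y
      rw [this, Preadditive.comp_add]
      exact H.add_mem (hx d) (hy d)
    | smul a x _ hx =>
      intro d
      have : tsp (a • x) = tsp (M := AA.{u} A) (ULift.up a) ≫ tsp x := by
        rw [tsp_comp]; rfl
      rw [this, ← Category.assoc]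
      exact hx _
  haveI : Module.Projective A P := (IsProjective.iff_projective P).2 hP
  obtain ⟨r, p, s, hps⟩ := exists_free.{u} (A := A) P
  have : u = ∑ i : Fin r, (ModuleCat.ofHom (LinearMap.proj i ∘ₗ s) : P ⟶ AA.{u} A) ≫
      tsp (u.hom (p (Pi.single i (one1 A)))) := by
    ext x
    have hx : x = p (s x) := (congrArg (fun t => t x) hps).symm
    have h2 : s x = ∑ i, (s x i).down • (Pi.single i (one1.{u} A) : Fin r → ULift.{u} A) := by
      funext j
      rw [Finset.sum_apply, Finset.sum_eq_single j]
      · rw [Pi.smul_apply, Pi.single_eq_same]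
        apply ULift.ext
        exact (mul_one _).symm
      · intro i _ hij
        rw [Pi.smul_apply, Pi.single_eq_of_ne hij.symm, smul_zero]
      · simp
    rw [ModuleCat.hom_sum]
    conv_lhs => rw [hx, h2, map_sum, map_sum]
    rw [LinearMap.sum_apply]
    refine Finset.sum_congr rfl fun i _ => ?_
    rw [map_smul, map_smul]
    rfl
  rw [this]
  exact H.sum_mem fun i _ => h1 _ (hu _) _

theorem lift_proj {P M N : ModuleCat.{u} A} (hP : Projective P) (q : M ⟶ N)
    (hq : Function.Surjective q.hom) (u : P ⟶ N) : ∃ v : P ⟶ M, v ≫ q = u := by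
  haveI : Epi q := (ModuleCat.epi_iff_surjective q).2 hq
  exact ⟨Projective.factorThru u q, Projective.factorThru_comp u q⟩

/-- The quotient map. -/
noncomputable def qm {M : ModuleCat.{u} A} (R : Submodule A M) : M ⟶ ModuleCat.of A (M ⧸ R) :=
  ModuleCat.ofHom R.mkQ

theorem qm_surj {M : ModuleCat.{u} A} (R : Submodule A M) : Function.Surjective (qm R).hom :=
  R.mkQ_surjective

theorem comp_qm_zero {P M : ModuleCat.{u} A} (R : Submodule A M) (u : P ⟶ M) :
    u ≫ qm R = 0 ↔ ∀ x, u.hom x ∈ R := by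
  constructor
  · intro h x
    have := congrArg (fun t => t.hom x) h
    exact (Submodule.Quotient.mk_eq_zero R).1 this
  · intro h
    ext x
    exact (Submodule.Quotient.mk_eq_zero R).2 (h x)

theorem qm_zero {M : ModuleCat.{u} A} (R : Submodule A M) (h : qm R = 0) : R = ⊤ := by
  rw [eq_top_iff]
  intro x _
  exact (comp_qm_zero R (𝟙 M)).1 (by rw [h, comp_zero]) x

variable (k : Type) [Field k] [Algebra k A] [FiniteDimensional k A]

/-- Euler form. -/
noncomputable def chi (T : Two.{u} A) (X : ModuleCat.{u} A) : ℚ :=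
  (Module.finrank k (T.P0 ⟶ X) : ℚ) - Module.finrank k (T.P1 ⟶ X)

section Family

variable {I : Type} [Fintype I] (T : I → Two.{u} A)

/-- Generators of the radical submodule. -/
def Gam0 (j : I) : Set (T j).P0 :=
  {m | (∃ n, m = (T j).f.hom n) ∨ ∃ (i : I) (g : (T i).C ⟶ (T j).C) (n : (T i).P0),
    ¬ IsIso ((Qf.{u} A).map g) ∧ m = (c0 g).hom n}

theorem key_case1 (hne : ∀ i j, i ≠ j → ¬ Nonempty ((T i).K ≅ (T j).K)) (hE : ∀ i j, E (T i) (T j))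
    (j : I) (hj : Submodule.span A (Gam0 T j) ≠ ⊤) :
    ∃ X : ModuleCat.{u} A, Module.Finite A X ∧ chi k (T j) X ≠ 0 ∧ ∀ i, i ≠ j → chi k (T i) X = 0 := by
  let R := Submodule.span A (Gam0 T j)
  let q := qm R
  have hfj : (T j).f ≫ q = 0 := (comp_qm_zero R _).2 fun x =>
    Submodule.subset_span (Or.inl ⟨x, rfl⟩)
  have hrad : ∀ (i : I) (g : (T i).C ⟶ (T j).C), ¬ IsIso ((Qf.{u} A).map g) → c0 g ≫ q = 0 :=
    fun i g hg => (comp_qm_zero R _).2 fun x => Submodule.subset_span (Or.inr ⟨i, g, x, hg, rfl⟩)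
  haveI := (T j).fin0
  have hfin : Module.Finite A (ModuleCat.of A ((T j).P0 ⧸ R)) :=
    inferInstanceAs (Module.Finite A ((T j).P0 ⧸ R))
  let L : ∀ i, ((T i).P0 ⟶ ModuleCat.of A ((T j).P0 ⧸ R)) →ₗ[k]
      ((T i).P1 ⟶ ModuleCat.of A ((T j).P0 ⧸ R)) := fun i => Linear.leftComp k _ (T i).f
  have hL : ∀ i u, L i u = (T i).f ≫ u := fun _ _ => rfl
  have hsurj : ∀ i, Function.Surjective (L i) := by
    intro i c
    obtain ⟨c', rfl⟩ := lift_proj (T i).proj1 q (qm_surj R) c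
    obtain ⟨a, b, e⟩ := hE i j c'
    refine ⟨a ≫ q, ?_⟩
    rw [hL, e, Preadditive.add_comp, Category.assoc, Category.assoc, hfj, comp_zero, add_zero]
  have hfd0 : ∀ i, FiniteDimensional k ((T i).P0 ⟶ ModuleCat.of A ((T j).P0 ⧸ R)) :=
    fun i => fd_hom k _ _ (T i).fin0 hfin
  refine ⟨ModuleCat.of A ((T j).P0 ⧸ R), hfin, ?_, ?_⟩
  · have h1 := LinearMap.finrank_range_add_finrank_ker (L j)
    rw [LinearMap.range_eq_top.2 (hsurj j), finrank_top] at h1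
    have h2 : LinearMap.ker (L j) ≠ ⊥ := by
      intro h
      apply hj
      apply qm_zero
      have : q ∈ LinearMap.ker (L j) := hfj
      rw [h] at this
      exact (Submodule.mem_bot k).1 this
    have h3 : 0 < Module.finrank k (LinearMap.ker (L j)) := by
      rw [Nat.pos_iff_ne_zero]
      intro h
      exact h2 (Submodule.finrank_eq_zero.1 h)
    have h4 : Module.finrank k ((T j).P1 ⟶ ModuleCat.of A ((T j).P0 ⧸ R)) <
      Module.finrank k ((T j).P0 ⟶ ModuleCat.of A ((T j).P0 ⧸ R)) := by omega
    have : (Module.finrank k ((T j).P1 ⟶ ModuleCat.of A ((T j).P0 ⧸ R)) : ℚ) <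
      Module.finrank k ((T j).P0 ⟶ ModuleCat.of A ((T j).P0 ⧸ R)) := by exact_mod_cast h4
    unfold chi
    linarith
  · intro i hij
    have hinj : Function.Injective (L i) := by
      rw [injective_iff_map_eq_zero]
      intro u hu
      rw [hL] at hu
      obtain ⟨v, rfl⟩ := lift_proj (T i).proj0 q (qm_surj R) u
      let H : AddSubgroup ((T i).P1 ⟶ (T j).P0) :=
        { carrier := {x | ∃ (w : (T i).P0 ⟶ (T j).P0) (b : (T i).P1 ⟶ (T j).P1), w ≫ q = 0 ∧
            x = (T i).f ≫ w + b ≫ (T j).f}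
          zero_mem' := ⟨0, 0, by simp, by simp⟩
          add_mem' := by
            rintro x y ⟨w, b, h, e⟩ ⟨w', b', h', e'⟩
            refine ⟨w + w', b + b', by rw [Preadditive.add_comp, h, h', add_zero], ?_⟩
            rw [e, e', Preadditive.comp_add, Preadditive.add_comp]
            abel
          neg_mem' := by
            rintro x ⟨w, b, h, e⟩
            refine ⟨-w, -b, by rw [Preadditive.neg_comp, h, neg_zero], ?_⟩
            rw [e, Preadditive.comp_neg, Preadditive.neg_comp]
            abel }
      have hH : (T i).f ≫ v ∈ H := by
        refine cover (T i).proj1 (T i).fin1 H (Gam0 T j) ?_ _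
          ((comp_qm_zero R _).1 (by rw [Category.assoc]; exact hu))
        rintro m (⟨n, rfl⟩ | ⟨l, g, n, hg, rfl⟩) d
        · refine ⟨0, d ≫ tsp n, zero_comp, ?_⟩
          rw [comp_zero, zero_add, Category.assoc, tsp_comp]
        · obtain ⟨a, b, e⟩ := hE i l (d ≫ tsp n)
          refine ⟨a ≫ c0 g, b ≫ c1 g, by rw [Category.assoc, hrad l g hg, comp_zero], ?_⟩
          rw [← tsp_comp, ← Category.assoc, e, Preadditive.add_comp, Category.assoc, Category.assoc,
            Category.assoc, c_comm]
      obtain ⟨w, b, hw, e⟩ := hH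
      let g : (T i).C ⟶ (T j).C := mk2Hom (T i).f (T j).f b (v - w) (by
        rw [Preadditive.comp_sub, e]; abel)
      have h2 := hrad i g (fun h => hne i j hij ⟨asIso ((Qf.{u} A).map g)⟩)
      have h3 : (v - w) ≫ q = 0 := h2
      rw [Preadditive.sub_comp, hw, sub_zero] at h3
      exact h3
    have := LinearEquiv.finrank_eq (LinearEquiv.ofBijective (L i) ⟨hinj, hsurj i⟩)
    unfold chi
    rw [this, sub_self]

end Family

theorem case1_surj (k : Type) [Field k] [Algebra k A] [FiniteDimensional k A]
    {I : Type} [Fintype I] (T : I → Two.{u} A) (hT : ∀ i, Indec (T i).K) (h : ∀ j, Submodule.span A (Gam0 T j) = ⊤) (j : I) :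
    Function.Surjective (T j).f.hom := by
  let Z : ModuleCat.{u} A := ModuleCat.of A PUnit.{u+1}
  have hZ : IsZero Z := ModuleCat.isZero_of_subsingleton _
  let z : Z ⟶ AA.{u} A := 0
  let G : Kb.{u} A := (Qf.{u} A).obj (mk2 z)
  let mk : ∀ j, (AA.{u} A ⟶ (T j).P0) → (mk2 z ⟶ (T j).C) := fun j v =>
    mk2Hom z (T j).f 0 v (hZ.eq_of_src _ _)
  let Mk : ∀ j, (AA.{u} A ⟶ (T j).P0) →+ (G ⟶ (T j).K) := fun j =>
    { toFun := fun v => (Qf.{u} A).map (mk j v)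
      map_zero' := by
        rw [← (Qf.{u} A).map_zero]
        exact congrArg _ (mk2_ext _ _ rfl rfl)
      map_add' := by
        intro v w
        rw [← (Qf.{u} A).map_add]
        exact congrArg _ (mk2_ext _ _ (hZ.eq_of_src _ _) rfl) }
  have hMk : ∀ j (x : G ⟶ (T j).K), ∃ v, x = Mk j v := by
    intro j x
    obtain ⟨φ, rfl⟩ := (Qf.{u} A).map_surjective x
    exact ⟨c0 φ, congrArg _ (mk2_ext _ _ (hZ.eq_of_src _ _) rfl)⟩
  have key := nakayama_finset k G (fun j => (T j).K) hT (fun i => fdK k (T i) (T i)) Finset.univ (by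
    intro j _ x
    obtain ⟨v, rfl⟩ := hMk j x
    have : v ∈ (radCl G (fun j => (T j).K) Finset.univ j).comap (Mk j) := by
      refine cover (IsProjective.iff_projective (AA.{u} A) |>.1 inferInstance) inferInstance _ (Gam0 T j) ?_ _
        (fun x => by rw [h j]; trivial)
      rintro m (⟨n, rfl⟩ | ⟨l, g, n, hg, rfl⟩) d
      · rw [AddSubgroup.mem_comap]
        have : Mk j (d ≫ tsp ((T j).f.hom n)) = 0 := by
          refine (mk2_map_eq_zero_iff _).2 ⟨d ≫ tsp n, hZ.eq_of_src _ _, ?_⟩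
          rw [Category.assoc, tsp_comp]
          rfl
        rw [this]
        exact AddSubgroup.zero_mem _
      · rw [AddSubgroup.mem_comap]
        refine AddSubgroup.subset_closure ⟨l, Finset.mem_univ _, Mk l (d ≫ tsp n), (Qf.{u} A).map g, hg, ?_⟩
        refine Eq.trans ?_ ((Qf.{u} A).map_comp _ _)
        refine congrArg _ (mk2_ext _ _ (hZ.eq_of_src _ _) ?_)
        change d ≫ tsp ((c0 g).hom n) = (d ≫ tsp n) ≫ c0 g
        rw [Category.assoc, tsp_comp]
    exact this)
  intro p
  have := key j (Finset.mem_univ _) (Mk j (tsp p))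
  obtain ⟨s, _, hs⟩ := (mk2_map_eq_zero_iff _).1 this
  have hs : tsp p = s ≫ (T j).f := hs
  refine ⟨s.hom (one1 A), ?_⟩
  have := congrArg (fun t => t.hom (one1 A)) hs
  exact this.symm.trans (one_smul A p)

end Two

namespace Two

variable {A : Type} [Ring A]

/-- Generators of the radical submodule in the second case. -/
def Gam1 {I : Type} (T : I → Two.{u} A) (s : ∀ j, (T j).P0 ⟶ (T j).P1) (j : I) : Set (T j).P1 :=
  {m | (∃ n, m = (s j).hom n) ∨ ∃ (i : I) (g : (T i).C ⟶ (T j).C) (n : (T i).P1),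
    ¬ IsIso ((Qf.{u} A).map g) ∧ m = ((𝟙 _ - (T i).f ≫ s i) ≫ c1 g).hom n}

theorem key_case2 (k : Type) [Field k] [Algebra k A] [FiniteDimensional k A]
    {I : Type} (T : I → Two.{u} A)
    (hne : ∀ i j, i ≠ j → ¬ Nonempty ((T i).K ≅ (T j).K))
    (s : ∀ j, (T j).P0 ⟶ (T j).P1) (hs : ∀ j, s j ≫ (T j).f = 𝟙 _)
    (j : I) (hj : Submodule.span A (Gam1 T s j) ≠ ⊤) :
    ∃ X : ModuleCat.{u} A, Module.Finite A X ∧ chi k (T j) X ≠ 0 ∧ ∀ i, i ≠ j → chi k (T i) X = 0 := by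
  let R := Submodule.span A (Gam1 T s j)
  let q := qm R
  have hsj : s j ≫ q = 0 := (comp_qm_zero R _).2 fun x =>
    Submodule.subset_span (Or.inl ⟨x, rfl⟩)
  have hrad : ∀ (i : I) (g : (T i).C ⟶ (T j).C), ¬ IsIso ((Qf.{u} A).map g) →
      ((𝟙 _ - (T i).f ≫ s i) ≫ c1 g) ≫ q = 0 :=
    fun i g hg => (comp_qm_zero R _).2 fun x => Submodule.subset_span (Or.inr ⟨i, g, x, hg, rfl⟩)
  haveI := (T j).fin1
  have hfin : Module.Finite A (ModuleCat.of A ((T j).P1 ⧸ R)) :=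
    inferInstanceAs (Module.Finite A ((T j).P1 ⧸ R))
  let L : ∀ i, ((T i).P0 ⟶ ModuleCat.of A ((T j).P1 ⧸ R)) →ₗ[k]
      ((T i).P1 ⟶ ModuleCat.of A ((T j).P1 ⧸ R)) := fun i => Linear.leftComp k _ (T i).f
  have hL : ∀ i u, L i u = (T i).f ≫ u := fun _ _ => rfl
  have hinj : ∀ i, Function.Injective (L i) := by
    intro i
    rw [injective_iff_map_eq_zero]
    intro u hu
    rw [hL] at hu
    have := congrArg (fun t => s i ≫ t) hu
    simp only [comp_zero] at this
    rw [← Category.assoc, hs, Category.id_comp] at this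
    exact this
  have hfd1 : ∀ i, FiniteDimensional k ((T i).P1 ⟶ ModuleCat.of A ((T j).P1 ⧸ R)) :=
    fun i => fd_hom k _ _ (T i).fin1 hfin
  refine ⟨ModuleCat.of A ((T j).P1 ⧸ R), hfin, ?_, ?_⟩
  · have h1 := LinearMap.finrank_range_of_inj (hinj j)
    have h2 : LinearMap.range (L j) ≠ ⊤ := by
      intro h
      apply hj
      apply qm_zero
      have : q ∈ LinearMap.range (L j) := by rw [h]; trivial
      obtain ⟨u, hu⟩ := this
      rw [hL] at hu
      have h3 : u = 0 := by
        have h4 := hsj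
        rw [← hu, ← Category.assoc, hs, Category.id_comp] at h4
        exact h4
      rw [h3, comp_zero] at hu
      exact hu.symm
    have h3 := Submodule.finrank_lt h2
    rw [h1] at h3
    have : (Module.finrank k ((T j).P0 ⟶ ModuleCat.of A ((T j).P1 ⧸ R)) : ℚ) <
      Module.finrank k ((T j).P1 ⟶ ModuleCat.of A ((T j).P1 ⧸ R)) := by exact_mod_cast h3
    unfold chi
    linarith
  · intro i hij
    have hsurj : Function.Surjective (L i) := by
      intro u
      obtain ⟨v, rfl⟩ := lift_proj (T i).proj1 q (qm_surj R) u
      have hsf : (𝟙 _ - (T i).f ≫ s i) ≫ (T i).f = 0 := by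
        rw [Preadditive.sub_comp, Category.assoc, hs]; simp
      have hsf' : (𝟙 _ - (T j).f ≫ s j) ≫ (T j).f = 0 := by
        rw [Preadditive.sub_comp, Category.assoc, hs]; simp
      let g : (T i).C ⟶ (T j).C := mk2Hom (T i).f (T j).f (v ≫ (𝟙 _ - (T j).f ≫ s j)) 0 (by
        rw [Category.assoc, hsf', comp_zero, comp_zero])
      have h2 := hrad i g (fun h => hne i j hij ⟨asIso ((Qf.{u} A).map g)⟩)
      have h3 : ((𝟙 _ - (T i).f ≫ s i) ≫ v ≫ (𝟙 _ - (T j).f ≫ s j)) ≫ q = 0 := h2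
      have h4 : (𝟙 _ - (T j).f ≫ s j) ≫ q = q := by
        rw [Preadditive.sub_comp, Category.assoc, hsj]; simp
      rw [Category.assoc, Category.assoc, h4, Preadditive.sub_comp, Category.id_comp,
        sub_eq_zero] at h3
      refine ⟨s i ≫ v ≫ q, ?_⟩
      rw [Category.assoc] at h3
      exact h3.symm
    have := LinearEquiv.finrank_eq (LinearEquiv.ofBijective (L i) ⟨hinj i, hsurj⟩)
    unfold chi
    rw [this, sub_self]

theorem case2_false (k : Type) [Field k] [Algebra k A] [FiniteDimensional k A]
    {I : Type} [Fintype I] (T : I → Two.{u} A) (hT : ∀ i, Indec (T i).K)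
    (s : ∀ j, (T j).P0 ⟶ (T j).P1) (hs : ∀ j, s j ≫ (T j).f = 𝟙 _)
    (h : ∀ j, Submodule.span A (Gam1 T s j) = ⊤) (j : I) : False := by
  let Z : ModuleCat.{u} A := ModuleCat.of A PUnit.{u+1}
  have hZ : IsZero Z := ModuleCat.isZero_of_subsingleton _
  let z : AA.{u} A ⟶ Z := 0
  let G : Kb.{u} A := (Qf.{u} A).obj (mk2 z)
  let ep : ∀ j, (T j).P1 ⟶ (T j).P1 := fun j => 𝟙 _ - (T j).f ≫ s j
  have hep : ∀ j, ep j = 𝟙 _ - (T j).f ≫ s j := fun _ => rfl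
  have hef : ∀ j, ep j ≫ (T j).f = 0 := by
    intro j
    rw [hep, Preadditive.sub_comp, Category.assoc, hs]; simp
  have hse : ∀ j, s j ≫ ep j = 0 := by
    intro j
    rw [hep, Preadditive.comp_sub, ← Category.assoc, hs]; simp
  have hfe : ∀ j (W : ModuleCat.{u} A) (u : W ⟶ (T j).P1), u ≫ (T j).f = 0 → u ≫ ep j = u := by
    intro j W u hu
    rw [hep, Preadditive.comp_sub, ← Category.assoc, hu]; simp
  let mk : ∀ j (v : AA.{u} A ⟶ (T j).P1), v ≫ (T j).f = 0 → (mk2 z ⟶ (T j).C) := fun j v hv =>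
    mk2Hom z (T j).f v 0 (by rw [hv, comp_zero])
  have hve : ∀ j (v : AA.{u} A ⟶ (T j).P1), (v ≫ ep j) ≫ (T j).f = 0 := fun j v => by
    rw [Category.assoc, hef, comp_zero]
  let Mk : ∀ j, (AA.{u} A ⟶ (T j).P1) →+ (G ⟶ (T j).K) := fun j =>
    { toFun := fun v => (Qf.{u} A).map (mk j (v ≫ ep j) (hve j v))
      map_zero' := by
        rw [← (Qf.{u} A).map_zero]
        exact congrArg _ (mk2_ext _ _ zero_comp rfl)
      map_add' := by
        intro v w
        rw [← (Qf.{u} A).map_add]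
        exact congrArg _ (mk2_ext _ _ (Preadditive.add_comp _ _ _ _ _ _) (hZ.eq_of_src _ _)) }
  have hMk : ∀ j (x : G ⟶ (T j).K), ∃ v, x = Mk j v := by
    intro j x
    obtain ⟨φ, rfl⟩ := (Qf.{u} A).map_surjective x
    have h1 : c1 φ ≫ (T j).f = 0 := by
      rw [c_comm φ]; exact zero_comp
    exact ⟨c1 φ, congrArg _ (mk2_ext _ _ (hfe j _ _ h1).symm (hZ.eq_of_src _ _))⟩
  have key := nakayama_finset k G (fun j => (T j).K) hT (fun i => fdK k (T i) (T i)) Finset.univ (by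
    intro j _ x
    obtain ⟨v, rfl⟩ := hMk j x
    have : v ∈ (radCl G (fun j => (T j).K) Finset.univ j).comap (Mk j) := by
      refine cover (IsProjective.iff_projective (AA.{u} A) |>.1 inferInstance) inferInstance _
        (Gam1 T s j) ?_ _ (fun x => by rw [h j]; trivial)
      rintro m (⟨n, rfl⟩ | ⟨l, g, n, hg, rfl⟩) d
      · rw [AddSubgroup.mem_comap]
        have : Mk j (d ≫ tsp ((s j).hom n)) = 0 := by
          refine (mk2_map_eq_zero_iff _).2 ⟨0, ?_, hZ.eq_of_src _ _⟩
          change (d ≫ tsp ((s j).hom n)) ≫ ep j = _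
          rw [← tsp_comp, Category.assoc, Category.assoc, hse, comp_zero, comp_zero, comp_zero]
        rw [this]
        exact AddSubgroup.zero_mem _
      · rw [AddSubgroup.mem_comap]
        refine AddSubgroup.subset_closure ⟨l, Finset.mem_univ _, Mk l (d ≫ tsp n), (Qf.{u} A).map g, hg, ?_⟩
        refine Eq.trans ?_ ((Qf.{u} A).map_comp _ _)
        refine congrArg _ (mk2_ext _ _ ?_ (hZ.eq_of_src _ _))
        change (d ≫ tsp ((ep l ≫ c1 g).hom n)) ≫ ep j = ((d ≫ tsp n) ≫ ep l) ≫ c1 g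
        rw [← tsp_comp]
        have h5 : (ep l ≫ c1 g) ≫ ep j = ep l ≫ c1 g := by
          apply hfe
          rw [Category.assoc, c_comm g, ← Category.assoc, hef, zero_comp]
        simp only [Category.assoc] at h5 ⊢
        rw [h5]
    exact this)
  have hep0 : ep j = 0 := by
    ext p
    have := key j (Finset.mem_univ _) (Mk j (tsp p))
    obtain ⟨t, ht, _⟩ := (mk2_map_eq_zero_iff _).1 this
    have ht : tsp p ≫ ep j = z ≫ t := ht
    have h6 : tsp p ≫ ep j = 0 := by rw [ht]; exact zero_comp
    rw [tsp_comp] at h6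
    have := congrArg (fun t => t.hom (one1 A)) h6
    exact (one_smul A ((ep j).hom p)).symm.trans this
  apply (hT j).1
  rw [IsZero.iff_id_eq_zero]
  have h7 : (Qf.{u} A).map (𝟙 (T j).C) = 0 := by
    refine (mk2_map_eq_zero_iff _).2 ⟨s j, ?_, ?_⟩
    · rw [hep, sub_eq_zero] at hep0
      exact hep0
    · exact (hs j).symm
  rw [(Qf.{u} A).map_id] at h7
  exact h7

theorem key_lemma (k : Type) [Field k] [Algebra k A] [FiniteDimensional k A]
    {I : Type} [Fintype I] [Nonempty I] (T : I → Two.{u} A) (hT : ∀ i, Indec (T i).K)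
    (hne : ∀ i j, i ≠ j → ¬ Nonempty ((T i).K ≅ (T j).K)) (hE : ∀ i j, E (T i) (T j)) :
    ∃ (j : I) (X : ModuleCat.{u} A), Module.Finite A X ∧ chi k (T j) X ≠ 0 ∧
      ∀ i, i ≠ j → chi k (T i) X = 0 := by
  by_cases h : ∀ j, Submodule.span A (Gam0 T j) = ⊤
  · have hs := case1_surj k T hT h
    choose s hs using fun j => lift_proj (T j).proj0 (T j).f (hs j) (𝟙 _)
    by_cases h2 : ∀ j, Submodule.span A (Gam1 T s j) = ⊤
    · exact (case2_false k T hT s hs h2 (Classical.arbitrary I)).elim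
    · push Not at h2
      obtain ⟨j, hj⟩ := h2
      exact ⟨j, key_case2 k T hne s hs j hj⟩
  · push Not at h
    obtain ⟨j, hj⟩ := h
    exact ⟨j, key_case1 k T hne hE j hj⟩

theorem chi_linInd (k : Type) [Field k] [Algebra k A] [FiniteDimensional k A]
    {I : Type} [Fintype I] (T : I → Two.{u} A) (hT : ∀ i, Indec (T i).K)
    (hne : ∀ i j, i ≠ j → ¬ Nonempty ((T i).K ≅ (T j).K)) (hE : ∀ i j, E (T i) (T j)) :
    LinearIndependent ℚ (fun (i : I) (X : {X : ModuleCat.{u} A // Module.Finite A X}) =>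
      chi k (T i) X.1) := by
  classical
  rw [Fintype.linearIndependent_iff]
  intro c hc
  by_contra hcon
  push Not at hcon
  obtain ⟨i0, hi0⟩ := hcon
  haveI : Nonempty {i // c i ≠ 0} := ⟨⟨i0, hi0⟩⟩
  obtain ⟨j, X, hX, h1, h2⟩ := key_lemma k (fun i : {i // c i ≠ 0} => T i.1) (fun i => hT _)
    (fun i j hij => hne _ _ (fun e => hij (Subtype.ext e))) (fun i j => hE _ _)
  have h3 := congrFun hc ⟨X, hX⟩
  rw [Finset.sum_apply, Finset.sum_eq_single j.1] at h3
  · simp only [Pi.smul_apply, smul_eq_mul, Pi.zero_apply, mul_eq_zero] at h3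
    exact h3.elim j.2 h1
  · intro i _ hij
    by_cases hci : c i = 0
    · simp [hci]
    · have := h2 ⟨i, hci⟩ (fun e => hij (congrArg Subtype.val e))
      simp [this]
  · simp

end Two

namespace Two

variable {A : Type} [Ring A]

/-- The hom dimension function of a module. -/
noncomputable def hdim (k : Type) [Field k] [Algebra k A] (V : ModuleCat.{u} A) :
    {X : ModuleCat.{u} A // Module.Finite A X} → ℚ := fun X => Module.finrank k (V ⟶ X.1)

theorem hdim_iso (k : Type) [Field k] [Algebra k A] {V W : ModuleCat.{u} A} (e : V ≅ W) :
    hdim k V = hdim k W := by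
  ext X
  unfold hdim
  congr 1
  refine LinearEquiv.finrank_eq
    { toFun := fun u => e.inv ≫ u
      invFun := fun u => e.hom ≫ u
      left_inv := fun u => by simp
      right_inv := fun u => by simp
      map_add' := fun u v => by simp
      map_smul' := fun c u => by simp }

theorem hdim_add (k : Type) [Field k] [Algebra k A] [FiniteDimensional k A]
    {U U' W : ModuleCat.{u} A} (hW : Module.Finite A W) (i : U ⟶ W) (r : W ⟶ U)
    (i' : U' ⟶ W) (r' : W ⟶ U') (h : i ≫ r = 𝟙 _) (h' : i' ≫ r' = 𝟙 _)
    (h1 : r ≫ i + r' ≫ i' = 𝟙 W) :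
    hdim k W = hdim k U + hdim k U' := by
  have e0 : r' ≫ i' = 𝟙 _ - r ≫ i := by rw [← h1]; abel
  have e1 : i ≫ r' = 0 := by
    have : i ≫ (r' ≫ i') ≫ r' = 0 := by
      rw [e0, Preadditive.sub_comp, Preadditive.comp_sub, Category.assoc, reassoc_of% h]
      simp
    simpa [h'] using this
  have e0' : r ≫ i = 𝟙 _ - r' ≫ i' := by rw [← h1]; abel
  have e2 : i' ≫ r = 0 := by
    have : i' ≫ (r ≫ i) ≫ r = 0 := by
      rw [e0', Preadditive.sub_comp, Preadditive.comp_sub, Category.assoc, reassoc_of% h']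
      simp
    simpa [h] using this
  ext X
  haveI := fd_hom k U X.1 (finite_of_retract i r h hW) X.2
  haveI := fd_hom k U' X.1 (finite_of_retract i' r' h' hW) X.2
  have : Module.finrank k (W ⟶ X.1) = Module.finrank k ((U ⟶ X.1) × (U' ⟶ X.1)) := by
    refine LinearEquiv.finrank_eq
      { toFun := fun u => (i ≫ u, i' ≫ u)
        invFun := fun u => r ≫ u.1 + r' ≫ u.2
        left_inv := fun u => by
          simp only [← Category.assoc, ← Preadditive.add_comp, h1, Category.id_comp]
        right_inv := fun u => by
          simp only [Preadditive.comp_add, reassoc_of% h, reassoc_of% h', reassoc_of% e1,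
            reassoc_of% e2, zero_comp, add_zero, zero_add]
        map_add' := fun u v => by simp
        map_smul' := fun c u => by simp }
  rw [Module.finrank_prod] at this
  simp only [Pi.add_apply, hdim, this]
  push_cast
  rfl

/-- Retracts of modules. -/
def MRet (V W : ModuleCat.{u} A) : Prop := ∃ (i : V ⟶ W) (r : W ⟶ V), i ≫ r = 𝟙 V

theorem MRet.trans {U V W : ModuleCat.{u} A} (h : MRet U V) (h' : MRet V W) : MRet U W := by
  obtain ⟨i, r, h⟩ := h
  obtain ⟨i', r', h'⟩ := h'
  exact ⟨i ≫ i', r' ≫ r, by simp only [Category.assoc]; rw [reassoc_of% h', h]⟩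

open scoped ModuleCat in
theorem mdecomp (k : Type) [Field k] [Algebra k A] [FiniteDimensional k A] :
    ∀ (n : ℕ) (W : ModuleCat.{u} A), Module.Finite A W → Module.finrank k W < n →
    ∃ l : List (ModuleCat.{u} A), (∀ V ∈ l, Indec V ∧ MRet V W) ∧
      hdim k W = (l.map (hdim k)).sum ∧
      ∀ Y, Indec Y → MRet Y W → ∃ V ∈ l, Nonempty (Y ≅ V) := by
  intro n
  induction n with
  | zero => intro W _ h; omega
  | succ n ih =>
    intro W hW hn
    by_cases hz : IsZero W
    · refine ⟨[], by simp, ?_, ?_⟩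
      · ext X
        simp only [List.map_nil, List.sum_nil, Pi.zero_apply, hdim]
        haveI : Subsingleton (W ⟶ X.1) := ⟨fun a b => hz.eq_of_src a b⟩
        rw [Module.finrank_zero_of_subsingleton, Nat.cast_zero]
      · rintro Y hY ⟨i, r, h⟩
        exact (hY.1 (isZero_of_retract i r h hz)).elim
    by_cases hi : Indec W
    · refine ⟨[W], ?_, by simp, ?_⟩
      · intro V hV
        rw [List.mem_singleton] at hV
        subst hV
        exact ⟨hi, 𝟙 _, 𝟙 _, Category.id_comp _⟩
      · rintro Y hY ⟨i, r, h⟩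
        haveI := isIso_of_retract_indec hY hi i r h
        exact ⟨W, List.mem_singleton_self _, ⟨asIso i⟩⟩
    have : ∃ e : W ⟶ W, e ≫ e = e ∧ e ≠ 0 ∧ e ≠ 𝟙 W := by
      by_contra hc
      push Not at hc
      refine hi ⟨hz, fun e he => ?_⟩
      by_cases h0 : e = 0
      · exact Or.inl h0
      · exact Or.inr (hc e he h0)
    obtain ⟨e, he, he0, he1⟩ := this
    have he' : (𝟙 _ - e) ≫ (𝟙 _ - e) = 𝟙 _ - e := by
      simp [Preadditive.sub_comp, Preadditive.comp_sub, he]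
    obtain ⟨U, i, r, h1, h2⟩ := IsIdempotentComplete.idempotents_split W e he
    obtain ⟨U', i', r', h1', h2'⟩ := IsIdempotentComplete.idempotents_split W _ he'
    have hd := retract_dim k hW i r h1
    have hd' := retract_dim k hW i' r' h1'
    obtain ⟨l, a1, a2, a3⟩ := ih U (finite_of_retract i r h1 hW) (by
      have : Module.finrank k U ≠ Module.finrank k W := fun hc => he1 (by rw [← h2, hd.2 hc])
      omega)
    obtain ⟨l', b1, b2, b3⟩ := ih U' (finite_of_retract i' r' h1' hW) (by
      have : Module.finrank k U' ≠ Module.finrank k W := fun hc => he0 (by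
        have h3 := hd'.2 hc
        rw [h2'] at h3
        have : e = 𝟙 _ - (𝟙 _ - e) := by abel
        rw [this, h3, sub_self])
      omega)
    have hsum : r ≫ i + r' ≫ i' = 𝟙 W := by rw [h2, h2']; abel
    refine ⟨l ++ l', ?_, ?_, ?_⟩
    · intro V hV
      rcases List.mem_append.1 hV with hV | hV
      · exact ⟨(a1 V hV).1, (a1 V hV).2.trans ⟨i, r, h1⟩⟩
      · exact ⟨(b1 V hV).1, (b1 V hV).2.trans ⟨i', r', h1'⟩⟩
    · rw [hdim_add k hW i r i' r' h1 h1' hsum, a2, b2, List.map_append, List.sum_append]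
    · rintro Y hY ⟨a, b, hab⟩
      have hYf := finite_of_retract a b hab hW
      haveI : FiniteDimensional k (End Y) := fd_hom k Y Y hYf hYf
      rcases indec_split k hY (a ≫ r) (i ≫ b) (a ≫ r') (i' ≫ b) (by
        rw [← hab]
        have := congrArg (fun t => a ≫ t ≫ b) hsum
        simpa [Preadditive.add_comp, Preadditive.comp_add] using this) with h | h
      · obtain ⟨V, hV, e⟩ := a3 Y hY h
        exact ⟨V, List.mem_append_left _ hV, e⟩
      · obtain ⟨V, hV, e⟩ := b3 Y hY h
        exact ⟨V, List.mem_append_right _ hV, e⟩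

theorem mret_free (k : Type) [Field k] [Algebra k A] [FiniteDimensional k A]
    {Y : ModuleCat.{u} A} (hY : Indec Y) (hYf : Module.Finite A Y) :
    ∀ n : ℕ, MRet Y (ModuleCat.of A (Fin n → ULift.{u} A)) → MRet Y (AA.{u} A) := by
  haveI : FiniteDimensional k (End Y) := fd_hom k Y Y hYf hYf
  intro n
  induction n with
  | zero =>
    rintro ⟨i, r, h⟩
    exact (hY.1 (isZero_of_retract i r h (ModuleCat.isZero_of_subsingleton _))).elim
  | succ n ih =>
    rintro ⟨i, r, h⟩
    let E := Fin.consLinearEquiv A (fun _ : Fin (n + 1) => ULift.{u} A)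
    let p1 : ModuleCat.of A (Fin (n + 1) → ULift.{u} A) ⟶ AA.{u} A :=
      ModuleCat.ofHom (LinearMap.fst A (ULift.{u} A) (Fin n → ULift.{u} A) ∘ₗ E.symm.toLinearMap)
    let p2 : ModuleCat.of A (Fin (n + 1) → ULift.{u} A) ⟶ ModuleCat.of A (Fin n → ULift.{u} A) :=
      ModuleCat.ofHom (LinearMap.snd A (ULift.{u} A) (Fin n → ULift.{u} A) ∘ₗ E.symm.toLinearMap)
    let j1 : AA.{u} A ⟶ ModuleCat.of A (Fin (n + 1) → ULift.{u} A) :=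
      ModuleCat.ofHom (E.toLinearMap ∘ₗ LinearMap.inl A (ULift.{u} A) (Fin n → ULift.{u} A))
    let j2 : ModuleCat.of A (Fin n → ULift.{u} A) ⟶ ModuleCat.of A (Fin (n + 1) → ULift.{u} A) :=
      ModuleCat.ofHom (E.toLinearMap ∘ₗ LinearMap.inr A (ULift.{u} A) (Fin n → ULift.{u} A))
    have hsum : p1 ≫ j1 + p2 ≫ j2 = 𝟙 _ := by
      apply ModuleCat.hom_ext
      refine LinearMap.ext fun x => ?_
      change E ((E.symm x).1, 0) + E (0, (E.symm x).2) = x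
      rw [← map_add]
      simp
    rcases indec_split k hY (i ≫ p1) (j1 ≫ r) (i ≫ p2) (j2 ≫ r) (by
        rw [← h]
        have := congrArg (fun t => i ≫ t ≫ r) hsum
        simpa [Preadditive.add_comp, Preadditive.comp_add] using this) with h | h
    · exact h
    · exact ih h

theorem indec_of_indecModule {N : Type} [AddCommGroup N] [Module A N] (h : IndecModule A N) :
    Indec (ModuleCat.of A (ULift.{u} N)) := by
  refine ⟨fun hz => ?_, fun e he => ?_⟩
  · haveI := h.1
    exact not_subsingleton (ULift.{u} N) (ModuleCat.subsingleton_of_isZero hz)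
  · let φ : ULift.{u} N ≃ₗ[A] N := ULift.moduleEquiv
    have he' : ∀ x, e.hom (e.hom x) = e.hom x := fun x => congrArg (fun t => t.hom x) he
    let e' : N →ₗ[A] N := φ.toLinearMap ∘ₗ e.hom ∘ₗ φ.symm.toLinearMap
    have hee : ∀ x, e' (φ x) = φ (e.hom x) := fun x => rfl
    have hid : IsIdempotentElem e' := by
      refine LinearMap.ext fun x => ?_
      change φ (e.hom (e.hom (φ.symm x))) = φ (e.hom (φ.symm x))
      rw [he']
    rcases h.2 _ _ (LinearMap.IsIdempotentElem.isCompl hid) with h0 | h0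
    · left
      apply ModuleCat.hom_ext
      refine LinearMap.ext fun x => ?_
      have : e' (φ x) ∈ LinearMap.range e' := ⟨_, rfl⟩
      rw [h0, hee, Submodule.mem_bot, LinearEquiv.map_eq_zero_iff] at this
      exact this
    · right
      apply ModuleCat.hom_ext
      refine LinearMap.ext fun x => ?_
      have : φ (e.hom x - x) ∈ LinearMap.ker e' := by
        rw [LinearMap.mem_ker, hee, map_sub, he', sub_self, map_zero]
      rw [h0, Submodule.mem_bot, LinearEquiv.map_eq_zero_iff, sub_eq_zero] at this
      exact this

theorem indecModule_of_indec {N : Type} [AddCommGroup N] [Module A N]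
    (h : Indec (ModuleCat.of A (ULift.{u} N))) : IndecModule A N := by
  refine ⟨?_, fun p q hpq => ?_⟩
  · by_contra hn
    rw [not_nontrivial_iff_subsingleton] at hn
    exact h.1 (ModuleCat.isZero_of_subsingleton _)
  · let φ : ULift.{u} N ≃ₗ[A] N := ULift.moduleEquiv
    let e : N →ₗ[A] N := p.projection q hpq
    have he : e ∘ₗ e = e := Submodule.isIdempotentElem_projection hpq
    let e' : ULift.{u} N →ₗ[A] ULift.{u} N := φ.symm.toLinearMap ∘ₗ e ∘ₗ φ.toLinearMap
    have he' : e' ∘ₗ e' = e' := by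
      refine LinearMap.ext fun x => ?_
      exact congrArg (fun t => φ.symm (t (φ x))) he
    rcases h.2 (ModuleCat.ofHom e') (by rw [← ModuleCat.ofHom_comp, he']) with h0 | h0
    · left
      rw [eq_bot_iff]
      intro x hx
      have h1 : e x = x := Submodule.projection_apply_left hpq ⟨x, hx⟩
      have h2 : e x = 0 := congrArg (fun t => φ (t.hom (φ.symm x))) h0
      rw [Submodule.mem_bot, ← h1, h2]
    · right
      rw [eq_bot_iff]
      intro x hx
      have h1 : e x = 0 := (Submodule.projection_apply_eq_zero_iff hpq).2 hx
      have h2 : e x = x := congrArg (fun t => φ (t.hom (φ.symm x))) h0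
      rw [Submodule.mem_bot, ← h2, h1]

end Two

theorem Indec.of_iso {C : Type*} [Category C] [Preadditive C] {X Y : C} (h : Indec X) (φ : X ≅ Y) :
    Indec Y := by
  refine ⟨fun hz => h.1 (hz.of_iso φ), fun e he => ?_⟩
  rcases h.2 (φ.hom ≫ e ≫ φ.inv) (by simp [reassoc_of% he]) with h0 | h0
  · left
    have := congrArg (fun t => φ.inv ≫ t ≫ φ.hom) h0
    simpa using this
  · right
    have := congrArg (fun t => φ.inv ≫ t ≫ φ.hom) h0
    simpa using this

namespace Two

/-- Indecomposable complemented submodules of the regular module. -/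
abbrev SubA (A : Type) [Ring A] := {N : Submodule A A //
      (∃ N' : Submodule A A, IsCompl N N') ∧ IndecModule A N}

/-- Their isomorphism classes. -/
abbrev QA (A : Type) [Ring A] := Quot (fun (X Y : SubA A) => Nonempty (X.1 ≃ₗ[A] Y.1))

variable {A : Type} [Ring A]

theorem exists_sub {Y : ModuleCat.{u} A} (hY : Indec Y) (h : MRet Y (AA.{u} A)) :
    ∃ N : SubA A, Nonempty (Y ≅ ModuleCat.of A (ULift.{u} N.1)) := by
  obtain ⟨i, r, h⟩ := h
  have hri : ∀ x, r.hom (i.hom x) = x := fun x => congrArg (fun t => t.hom x) h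
  have hi : Function.Injective i.hom := Function.LeftInverse.injective hri
  let ψ : ULift.{u} A ≃ₗ[A] A := ULift.moduleEquiv
  let i' : Y →ₗ[A] A := ψ.toLinearMap ∘ₗ i.hom
  let r' : A →ₗ[A] Y := r.hom ∘ₗ ψ.symm.toLinearMap
  have hri' : ∀ x, r' (i' x) = x := fun x => hri x
  have hi' : Function.Injective i' := Function.LeftInverse.injective hri'
  let N : Submodule A A := LinearMap.range i'
  let e : Y ≃ₗ[A] N := LinearEquiv.ofInjective i' hi'
  let φ : Y ≅ ModuleCat.of A (ULift.{u} N) :=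
    LinearEquiv.toModuleIso (e.trans ULift.moduleEquiv.symm)
  refine ⟨⟨N, ⟨LinearMap.ker r', ?_⟩, indecModule_of_indec.{u} (hY.of_iso φ)⟩, ⟨φ⟩⟩
  constructor
  · rw [Submodule.disjoint_def]
    rintro _ ⟨y, rfl⟩ hx
    have : r' (i' y) = 0 := hx
    rw [hri'] at this
    rw [this, map_zero]
  · rw [codisjoint_iff, eq_top_iff]
    intro x _
    have hx : x = i' (r' x) + (x - i' (r' x)) := by abel
    rw [hx]
    refine Submodule.add_mem_sup ⟨_, rfl⟩ ?_
    rw [LinearMap.mem_ker, map_sub, hri', sub_self]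

theorem sub_mret (N : SubA A) : MRet (ModuleCat.of A (ULift.{u} N.1)) (AA.{u} A) := by
  obtain ⟨N', h⟩ := N.2.1
  let ψ : ULift.{u} A ≃ₗ[A] A := ULift.moduleEquiv
  let φ : ULift.{u} N.1 ≃ₗ[A] N.1 := ULift.moduleEquiv
  refine ⟨ModuleCat.ofHom (ψ.symm.toLinearMap ∘ₗ N.1.subtype ∘ₗ φ.toLinearMap),
    ModuleCat.ofHom (φ.symm.toLinearMap ∘ₗ N.1.projectionOnto N' h ∘ₗ ψ.toLinearMap), ?_⟩
  apply ModuleCat.hom_ext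
  refine LinearMap.ext fun x => ?_
  exact congrArg φ.symm (Submodule.projectionOnto_apply_left h (φ x))

theorem sub_indec (N : SubA A) : Indec (ModuleCat.of A (ULift.{u} N.1)) := indec_of_indecModule N.2.2

theorem finite_QA (k : Type) [Field k] [Algebra k A] [FiniteDimensional k A] : Finite (QA A) := by
  obtain ⟨l, -, -, h⟩ := mdecomp k _ (AA.{0} A) inferInstance (Nat.lt_succ_self _)
  have : ∀ c : QA A, ∃ V : {V // V ∈ l}, Nonempty (ModuleCat.of A (ULift.{0} c.out.1) ≅ V.1) := by
    intro c
    obtain ⟨V, hV, e⟩ := h _ (sub_indec c.out) (sub_mret c.out)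
    exact ⟨⟨V, hV⟩, e⟩
  choose V hV using this
  haveI : Finite {V // V ∈ l} := (List.finite_toSet l).to_subtype
  refine Finite.of_injective V ?_
  intro c c' hc
  obtain ⟨e⟩ := hV c
  obtain ⟨e'⟩ := hV c'
  rw [← hc] at e'
  rw [← Quot.out_eq c, ← Quot.out_eq c']
  exact Quot.sound ⟨(ULift.moduleEquiv.symm.trans (e ≪≫ e'.symm).toLinearEquiv).trans ULift.moduleEquiv⟩

/-- The basic hom dimension functions. -/
noncomputable def bas (k : Type) [Field k] [Algebra k A] (c : QA A) :
    {X : ModuleCat.{u} A // Module.Finite A X} → ℚ := hdim k (ModuleCat.of A (ULift.{u} c.out.1))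

theorem hdim_mem (k : Type) [Field k] [Algebra k A] [FiniteDimensional k A]
    (V : ModuleCat.{u} A) (hf : Module.Finite A V) (hp : Projective V) :
    hdim k V ∈ Submodule.span ℚ (Set.range (bas k (A := A))) := by
  obtain ⟨l, h1, h2, -⟩ := mdecomp k _ V hf (Nat.lt_succ_self _)
  rw [h2]
  apply list_sum_mem
  intro x hx
  obtain ⟨W, hW, rfl⟩ := List.mem_map.1 hx
  obtain ⟨hWi, hWr⟩ := h1 W hW
  haveI : Module.Projective A V := (IsProjective.iff_projective V).2 hp
  obtain ⟨r, p, s, hps⟩ := exists_free.{u} (A := A) V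
  have hV : MRet V (ModuleCat.of A (Fin r → ULift.{u} A)) :=
    ⟨ModuleCat.ofHom s, ModuleCat.ofHom p, by rw [← ModuleCat.ofHom_comp, hps]; rfl⟩
  have hWf : Module.Finite A W := by
    obtain ⟨i, r, h⟩ := hWr
    exact finite_of_retract i r h hf
  obtain ⟨N, ⟨e⟩⟩ := exists_sub hWi (mret_free k hWi hWf r (hWr.trans hV))
  refine Submodule.subset_span ⟨Quot.mk _ N, ?_⟩
  have h3 : Relation.EqvGen (fun (X Y : SubA A) => Nonempty (X.1 ≃ₗ[A] Y.1))
    (Quot.mk _ N : QA A).out N := Quot.eqvGen_exact (Quot.out_eq _)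
  have h4 : ∀ X Y : SubA A, Relation.EqvGen (fun (X Y : SubA A) => Nonempty (X.1 ≃ₗ[A] Y.1)) X Y →
      Nonempty (X.1 ≃ₗ[A] Y.1) := by
    intro X Y h
    induction h with
    | rel _ _ h => exact h
    | refl => exact ⟨LinearEquiv.refl _ _⟩
    | symm _ _ _ ih => exact ih.map LinearEquiv.symm
    | trans _ _ _ _ _ i1 i2 => obtain ⟨a⟩ := i1; obtain ⟨b⟩ := i2; exact ⟨a.trans b⟩
  obtain ⟨t⟩ := h4 _ _ h3
  exact hdim_iso k (((ULift.moduleEquiv.trans t).trans ULift.moduleEquiv.symm).toModuleIso ≪≫ e.symm)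

theorem card_le (k : Type) [Field k] [Algebra k A] [FiniteDimensional k A]
    {I : Type} [Fintype I] (T : I → Two.{u} A) (hT : ∀ i, Indec (T i).K)
    (hne : ∀ i j, i ≠ j → ¬ Nonempty ((T i).K ≅ (T j).K)) (hE : ∀ i j, E (T i) (T j)) :
    Fintype.card I ≤ numIndecSummandsRing A := by
  have hl := chi_linInd k T hT hne hE
  haveI := finite_QA (A := A) k
  letI := Fintype.ofFinite (QA A)
  letI : Fintype (Set.range (bas k (A := A))) := Fintype.ofFinite _
  have h1 := linearIndependent_le_span' _ hl (Set.range (bas k (A := A))) (by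
    rintro _ ⟨i, rfl⟩
    change hdim k (T i).P0 - hdim k (T i).P1 ∈ Submodule.span ℚ (Set.range (bas k (A := A)))
    exact Submodule.sub_mem _ (hdim_mem k _ (T i).fin0 (T i).proj0)
      (hdim_mem k _ (T i).fin1 (T i).proj1))
  rw [Cardinal.mk_fintype] at h1
  have h2 : Fintype.card I ≤ Fintype.card (Set.range (bas k (A := A))) := by exact_mod_cast h1
  have h3 : Fintype.card (Set.range (bas k (A := A))) ≤ Fintype.card (QA A) :=
    Fintype.card_range_le _
  have h4 : numIndecSummandsRing A = Fintype.card (QA A) := Nat.card_eq_fintype_card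
  omega

end Two

namespace Two
variable {A : Type} [Ring A]

/-- The isomorphism classes of indecomposable summands. -/
abbrev QM (M : Kb.{u} A) := Quot (fun (X Y : {N : Kb.{u} A // IndecObj N ∧ IsSummandOf N M}) =>
    Nonempty (X.1 ≅ Y.1))

theorem exists_inj (M : Kb.{u} A) : ∃ f : Fin (numIndecSummands M) → QM M, Function.Injective f := by
  rcases finite_or_infinite (QM M) with h | h
  · exact ⟨(Finite.equivFin (QM M)).symm, Equiv.injective _⟩
  · exact ⟨fun i => Infinite.natEmbedding (QM M) i.1,
      fun i j hij => Fin.ext ((Infinite.natEmbedding (QM M)).injective hij)⟩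

theorem summand_of_iso {N M M' : Kb.{u} A} (e : M ≅ M') (h : IsSummandOf N M) : IsSummandOf N M' := by
  obtain ⟨i, r, h⟩ := h
  exact ⟨i ≫ e.hom, e.inv ≫ r, by simp [h]⟩

theorem complete (k : Type) [Field k] [Algebra k A] [FiniteDimensional k A]
    (M : Kb.{u} A) (F : Two.{u} A) (φ : M ≅ F.K) (hF : E F F)
    (hcard : numIndecSummands M = numIndecSummandsRing A)
    (X : Two.{u} A) (h1 : E F X) (h2 : E X F) (h3 : E X X) (hX : Indec X.K) :
    ∃ N : Kb.{u} A, IsSummandOf N M ∧ Nonempty (X.K ≅ N) := by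
  by_contra hcon
  push Not at hcon
  obtain ⟨f, hf⟩ := exists_inj M
  have : ∀ i, ∃ T : Two.{u} A, Ret T F ∧ Nonempty (T.K ≅ (f i).out.1) := fun i =>
    of_summand k F _ (summand_of_iso φ (f i).out.2.2)
  choose T hT1 hT2 using this
  have hne : ∀ i, ¬ Nonempty (X.K ≅ (T i).K) := by
    rintro i ⟨e⟩
    obtain ⟨e'⟩ := hT2 i
    exact (hcon _ (f i).out.2.2).false (e ≪≫ e')
  let T' : Option (Fin (numIndecSummands M)) → Two.{u} A := fun o => o.elim X T
  have := card_le k T' (by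
      rintro (_ | i)
      · exact hX
      · obtain ⟨e'⟩ := hT2 i
        exact Indec.of_iso (X := (f i).out.1) (f i).out.2.1 e'.symm) (by
      rintro (_ | i) (_ | j) hij
      · exact (hij rfl).elim
      · exact hne j
      · rintro ⟨e⟩
        exact hne i ⟨e.symm⟩
      · rintro ⟨e⟩
        obtain ⟨e1⟩ := hT2 i
        obtain ⟨e2⟩ := hT2 j
        apply hij
        have : f i = f j := by
          rw [← Quot.out_eq (f i), ← Quot.out_eq (f j)]
          exact Quot.sound ⟨e1.symm ≪≫ e ≪≫ e2⟩
        rw [hf this]) (by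
      rintro (_ | i) (_ | j)
      · exact h3
      · exact E.right (hT1 j) h2
      · exact E.left (hT1 i) h1
      · exact E.left (hT1 i) (E.right (hT1 j) hF))
  rw [Fintype.card_option, Fintype.card_fin] at this
  omega

/-- The stalk complex of the regular module. -/
noncomputable abbrev stalk (A : Type) [Ring A] : CochainComplex (ModuleCat.{u} A) ℤ :=
  (CochainComplex.singleFunctor (ModuleCat.{u} A) 0).obj (ModuleCat.of A (ULift.{u} A))

theorem stalk_zero (i : ℤ) (h : i ≠ 0) : IsZero ((stalk.{u} A).X i) :=
  HomologicalComplex.isZero_single_obj_X (ComplexShape.up ℤ) 0 (ModuleCat.of A (ULift.{u} A)) i h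

/-- The degree zero part. -/
noncomputable def stalkIso : (stalk.{u} A).X 0 ≅ ModuleCat.of A (ULift.{u} A) :=
  HomologicalComplex.singleObjXSelf (ComplexShape.up ℤ) 0 (ModuleCat.of A (ULift.{u} A))

theorem stalk_proj (i : ℤ) : Projective ((stalk.{u} A).X i) := by
  by_cases h : i = 0
  · subst h
    exact projective_of_retract stalkIso.hom stalkIso.inv (Iso.hom_inv_id _)
      (IsProjective.iff_projective (AA.{u} A) |>.1 inferInstance)
  · exact (stalk_zero i h).projective

theorem stalk_fin (i : ℤ) : Module.Finite A ((stalk.{u} A).X i) := by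
  by_cases h : i = 0
  · subst h
    exact finite_of_retract stalkIso.hom stalkIso.inv (Iso.hom_inv_id _)
      (inferInstanceAs (Module.Finite A (ULift.{u} A)))
  · haveI := ModuleCat.subsingleton_of_isZero (stalk_zero (A := A) i h)
    infer_instance

end Two

/-- Let `A` be a finite-dimensional hereditary algebra over a field `k` and let `M` be a
2-term complex in `K^b(proj A)` (given by a complex `P` of finitely generated projective
modules concentrated in degrees `−1` and `0`).  If `M` is presilting and the number of
isomorphism classes of indecomposable direct summands of `M` equals that of `A`, then
`M` is silting: `thick(M) = K^b(proj A)`. -/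
theorem two_term_presilting_is_silting
    (k : Type) [Field k] (A : Type) [Ring A] [Algebra k A] [FiniteDimensional k A]
    (hHered : ∀ (P : Type) [AddCommGroup P] [Module A P], Module.Projective A P →
      ∀ N : Submodule A P, Module.Projective A N)
    (P : CochainComplex (ModuleCat A) ℤ)
    (hP2 : ∀ i : ℤ, i ≠ -1 → i ≠ 0 → IsZero (P.X i))
    (hPproj : ∀ i : ℤ, Projective (P.X i))
    (hPfin : ∀ i : ℤ, Module.Finite A (P.X i))
    (M : Kb A)
    (hM : M = (HomotopyCategory.quotient (ModuleCat A) (ComplexShape.up ℤ)).obj P)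
    (hpresilting : ∀ i : ℤ, 0 < i → ∀ f : M ⟶ M⟦i⟧, f = 0)
    (hcard : numIndecSummands M = numIndecSummandsRing A) :
    thickClosure M = {X : Kb A | inKbProj X} := by
  subst hM
  let F : Two A := Two.ofC P hPproj hPfin
  let φ : (Qf A).obj P ≅ F.K := (Qf A).mapIso (Two.ofCIso P hP2 hPproj hPfin)
  have hF : Two.E F F := by
    refine ext0_of_hom_zero F.f F.f fun t => ?_
    have h1 := hpresilting 1 one_pos (φ.hom ≫ t ≫ (shiftFunctor (Kb A) (1 : ℤ)).map φ.inv)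
    have h2 : φ.inv ≫ (φ.hom ≫ t ≫ (shiftFunctor (Kb A) (1 : ℤ)).map φ.inv) ≫
        (shiftFunctor (Kb A) (1 : ℤ)).map φ.hom = t := by
      simp only [Category.assoc, Iso.inv_hom_id_assoc, ← Functor.map_comp, Iso.inv_hom_id]
      rw [CategoryTheory.Functor.map_id]
      exact Category.comp_id t
    rw [← h2, h1, zero_comp, comp_zero]
  have hMem : inKbProj ((Qf A).obj P) :=
    ⟨P, ⟨-1, 0, fun i hi => hP2 i (by omega) (by omega)⟩, fun i => ⟨hPproj i, hPfin i⟩,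
      ⟨Iso.refl _⟩⟩
  ext X
  constructor
  · intro hX
    have hT := thickSet_inKbProj (A := A) k
    exact hX _ hMem hT.iso hT.shift hT.cone hT.summand
  · intro hX S hMS s1 s2 s3 s4
    have hS : ThickSet S := ⟨s1, s2, s3, s4⟩
    refine hS.inKbProj_mem ?_ X hX
    let E' : Two A := Two.ofC (Two.stalk A) Two.stalk_proj Two.stalk_fin
    have hE' : ∀ G, Two.E F G → Two.E E' G := fun G _ c =>
      ⟨0, 0, (Two.stalk_zero (A := A) (-1) (by omega)).eq_of_src _ _⟩
    obtain ⟨E'', h1, h2, h3⟩ := Two.bongartz k F hF _ E' (Nat.lt_succ_self _) hE'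
    have hFS : F.K ∈ S := s1 _ _ φ hMS
    have hE'' : E''.K ∈ S := by
      refine Two.decomp k hS ⟨_, hFS⟩ _ E'' (Nat.lt_succ_self _) fun T hT hTi => ?_
      obtain ⟨N, hN, ⟨e⟩⟩ := Two.complete k _ F φ hF hcard T (Two.E.right hT h1)
        (Two.E.left hT (h2 F hF)) (Two.E.left hT (Two.E.right hT (h2 E'' h1))) hTi
      exact s1 _ _ e.symm (s4 _ _ hN hMS)
    have h4 := h3 S hS hFS hE''
    exact s1 _ _ ((Qf A).mapIso (Two.ofCIso (Two.stalk A)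
      (fun i _ h => Two.stalk_zero i h) Two.stalk_proj Two.stalk_fin)).symm h4
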